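/- arXiv:1808.08637 — 6 statements merged into one kernel-verified Lean document; each statement's English description precedes it below -/
import Mathlib

section
/- Let η ∈ S¹ ⊂ ℝ² and m ≥ 1. Then for every x ∈ ℝ² \ {0}: (η·∇)^m ln(1/|x|) = (−1)^m (m−1)! T_m(x·η/|x|) |x|^{−m}, where T_m is the m-th degree Chebyshev polynomial of the first kind (normalized by T_m(1) = 1). -/
open scoped RealInnerProductSpace

theorem norm_ofReal_add_sq (w : ℂ) (t : ℝ) :
    ‖(t : ℂ) + w‖ ^ 2 = (t + w.re) ^ 2 + w.im ^ 2 := by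
  rw [← Complex.normSq_eq_norm_sq, Complex.normSq_apply]
  simp
  ring

theorem hasDerivAt_log_one_div_norm_ofReal_add (w : ℂ) (t : ℝ) (h : (t : ℂ) + w ≠ 0) :
    HasDerivAt (fun s : ℝ => Real.log (1 / ‖(s : ℂ) + w‖)) (-(((t : ℂ) + w)⁻¹).re) t := by
  have hlog : (fun s : ℝ => Real.log (1 / ‖(s : ℂ) + w‖)) =
      fun s : ℝ => -(Real.log ((s + w.re) ^ 2 + w.im ^ 2) / 2) := by
    funext s
    rw [← norm_ofReal_add_sq, Real.log_pow, one_div, Real.log_inv]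
    push_cast
    ring
  have hpos : (t + w.re) ^ 2 + w.im ^ 2 ≠ 0 := by
    rw [← norm_ofReal_add_sq]
    exact pow_ne_zero _ (norm_ne_zero_iff.mpr h)
  rw [hlog]
  have hd := (((((hasDerivAt_id t).add_const w.re).pow 2).add_const (w.im ^ 2)).log
    hpos).div_const 2 |>.neg
  refine hd.congr_deriv ?_
  rw [Complex.inv_re, Complex.normSq_eq_norm_sq, norm_ofReal_add_sq]
  simp
  field_simp

theorem hasDerivAt_re_inv_pow_ofReal_add (w : ℂ) (t : ℝ) (h : (t : ℂ) + w ≠ 0) (n : ℕ) :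
    HasDerivAt (fun s : ℝ => ((((s : ℂ) + w) ^ n)⁻¹).re)
      (-(n : ℝ) * ((((t : ℂ) + w) ^ (n + 1))⁻¹).re) t := by
  have hd : HasDerivAt (fun z : ℂ => ((z + w) ^ n)⁻¹)
      (((-(n : ℝ) : ℝ) : ℂ) * (((t : ℂ) + w) ^ (n + 1))⁻¹) (t : ℂ) := by
    have h1 := (((hasDerivAt_id (t : ℂ)).add_const w).pow n).inv (pow_ne_zero n h)
    refine h1.congr_deriv ?_
    rcases n with _ | n
    · simp
    · simp
      field_simp
      ring
  have hre := hd.real_of_complex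
  rwa [Complex.re_ofReal_mul] at hre

theorem iteratedDeriv_log_one_div_norm_ofReal_add (w : ℂ) (k : ℕ) (t : ℝ)
    (h : (t : ℂ) + w ≠ 0) :
    iteratedDeriv (k + 1) (fun s : ℝ => Real.log (1 / ‖(s : ℂ) + w‖)) t =
      (-1) ^ (k + 1) * (k.factorial : ℝ) * ((((t : ℂ) + w) ^ (k + 1))⁻¹).re := by
  induction k generalizing t with
  | zero =>
    rw [zero_add, iteratedDeriv_one, (hasDerivAt_log_one_div_norm_ofReal_add w t h).deriv]
    simp
  | succ k ih =>
    have hev : ∀ᶠ s : ℝ in nhds t, (s : ℂ) + w ≠ 0 :=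
      ContinuousAt.eventually_ne (by fun_prop) h
    rw [iteratedDeriv_succ, Filter.EventuallyEq.deriv_eq (hev.mono ih),
      ((hasDerivAt_re_inv_pow_ofReal_add w t h (k + 1)).const_mul _).deriv, Nat.factorial_succ]
    push_cast
    ring

theorem re_inv_pow_eq_chebyshev (w : ℂ) (hw : w ≠ 0) (m : ℕ) :
    ((w ^ m)⁻¹).re =
      (Polynomial.Chebyshev.T ℝ (m : ℤ)).eval (w.re / ‖w‖) / ‖w‖ ^ m := by
  have hn : ‖w‖ ≠ 0 := norm_ne_zero_iff.mpr hw
  have hp : w ^ m = ((‖w‖ ^ m : ℝ) : ℂ) * Complex.exp (((m * w.arg : ℝ) : ℂ) * Complex.I) := by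
    conv_lhs => rw [← Complex.norm_mul_exp_arg_mul_I w, mul_pow, ← Complex.exp_nat_mul]
    push_cast
    ring_nf
  have hre : (w ^ m).re = ‖w‖ ^ m * Real.cos (m * w.arg) := by
    rw [hp, Complex.re_ofReal_mul, Complex.exp_ofReal_mul_I_re]
  rw [← Complex.cos_arg hw, Polynomial.Chebyshev.T_real_cos, Complex.inv_re, hre,
    Complex.normSq_eq_norm_sq, norm_pow, Int.cast_natCast]
  field_simp

theorem exists_complex_norm_add_smul {E : Type*} [NormedAddCommGroup E] [InnerProductSpace ℝ E]
    (x η : E) (hη : ‖η‖ = 1) :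
    ∃ w : ℂ, w.re = ⟪x, η⟫ ∧ ∀ t : ℝ, ‖x + t • η‖ = ‖(t : ℂ) + w‖ := by
  have hb : 0 ≤ ‖x‖ ^ 2 - ⟪x, η⟫ ^ 2 := by
    have h := abs_real_inner_le_norm x η
    rw [hη, mul_one] at h
    exact sub_nonneg.mpr (sq_le_sq.mpr (by rwa [abs_norm]))
  refine ⟨⟨⟪x, η⟫, √(‖x‖ ^ 2 - ⟪x, η⟫ ^ 2)⟩, rfl, fun t => ?_⟩
  rw [← sq_eq_sq₀ (norm_nonneg _) (norm_nonneg _), norm_ofReal_add_sq, Real.sq_sqrt hb,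
    norm_add_sq_real, norm_smul, hη, inner_smul_right, mul_one, Real.norm_eq_abs, sq_abs]
  ring

/-- `(η·∇)^m ln(1/|x|) = (-1)^m (m-1)! T_m(x·η/|x|) |x|^{-m}` on `ℝ² \ {0}`, where `T_m` is
the Chebyshev polynomial of the first kind. The iterated directional derivative
`(η·∇)^m f (x)` is formalized as the `m`-th derivative at `t = 0` of `t ↦ f(x + t • η)`. -/
theorem stmt5 (m : ℕ) (hm : 1 ≤ m) (η : EuclideanSpace ℝ (Fin 2)) (hη : ‖η‖ = 1)
    (x : EuclideanSpace ℝ (Fin 2)) (hx : x ≠ 0) :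
    iteratedDeriv m (fun t : ℝ => Real.log (1 / ‖x + t • η‖)) 0
      = (-1 : ℝ) ^ m * ((m - 1).factorial : ℝ) *
          (Polynomial.Chebyshev.T ℝ (m : ℤ)).eval (⟪x, η⟫ / ‖x‖) / ‖x‖ ^ m := by
  obtain ⟨w, hre, hw⟩ := exists_complex_norm_add_smul x η hη
  have hxw : ‖x‖ = ‖w‖ := by simpa using hw 0
  have hw0 : w ≠ 0 := norm_ne_zero_iff.mp (hxw ▸ norm_ne_zero_iff.mpr hx)
  obtain ⟨k, rfl⟩ := Nat.exists_eq_add_of_le' hm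
  simp_rw [hw]
  rw [iteratedDeriv_log_one_div_norm_ofReal_add w k 0 (by simpa using hw0), Complex.ofReal_zero,
    zero_add, re_inv_pow_eq_chebyshev w hw0, hre, hxw, Nat.add_sub_cancel, mul_div_assoc]
end

section
/- Let d ≥ 3, m ∈ ℕ, 0 < ε ≤ 1, and a := 1 + ε. Then there exists a constant c > 0 depending only on m and d such that for all x, η ∈ S^{d-1}: |(η·∇)^m |x−aη|^{2−d}| ≤ c ε^{−m+1} ε^{−d+1} (1 + ε^{−1} ρ(x,η))^{−(m+d−2)}, where (η·∇)^m is applied to the function y ↦ |y − aη|^{2−d} on ℝ^d \ {aη} and then evaluated at x ∈ S^{d-1}. -/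
open scoped RealInnerProductSpace

theorem Real.exists_abs_iteratedDeriv_quadratic_rpow_le (p : ℝ) (m : ℕ) :
    ∃ C : ℝ, 0 < C ∧ ∀ b e D : ℝ, |b| ≤ D → |2 * e| ≤ D ^ 2 → 0 ≤ D →
      |iteratedDeriv m (fun t : ℝ => (1 + b * t + e * t ^ 2) ^ p) 0| ≤ C * D ^ m := by
  set B : ℝ := ∑ i ∈ Finset.range (m + 1),
    ‖iteratedFDeriv ℝ i (fun z : ℝ => z ^ p) 1‖ with hB
  have hB0 : 0 ≤ B := Finset.sum_nonneg fun i _ => norm_nonneg _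
  refine ⟨m.factorial * (B + 1), by positivity, fun b e D hb he hD => ?_⟩
  set f : ℝ → ℝ := fun t => 1 + b * t + e * t ^ 2 with hf
  have hfc : ContDiff ℝ m f := by fun_prop
  have hs : IsOpen (f ⁻¹' Set.Ioi 0) := isOpen_Ioi.preimage hfc.continuous
  have h0 : (0 : ℝ) ∈ f ⁻¹' Set.Ioi 0 := by simp [hf]
  have hf0 : f 0 = 1 := by simp [hf]
  have d1 : deriv f = fun t => b + (2 * e) * t := by
    ext t
    have h : HasDerivAt f (0 + b * 1 + e * (((2 : ℕ) : ℝ) * t ^ (2 - 1) * 1)) t :=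
      (((hasDerivAt_const t (1 : ℝ)).add ((hasDerivAt_id t).const_mul b)).add
        (((hasDerivAt_id t).pow 2).const_mul e))
    rw [h.deriv]
    push_cast
    ring
  have d2 : deriv (fun t : ℝ => b + (2 * e) * t) = fun _ => 2 * e := by
    ext t
    have h : HasDerivAt (fun t : ℝ => b + (2 * e) * t) (0 + (2 * e) * 1) t :=
      (hasDerivAt_const t b).add ((hasDerivAt_id t).const_mul (2 * e))
    rw [h.deriv]
    ring
  have key := norm_iteratedFDerivWithin_comp_le (𝕜 := ℝ) (g := fun z : ℝ => z ^ p) (f := f)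
    (n := m) (N := m) (s := f ⁻¹' Set.Ioi 0) (t := Set.Ioi 0) (x := 0)
    (fun z hz => (Real.contDiffAt_rpow_const_of_ne (ne_of_gt hz)).contDiffWithinAt)
    hfc.contDiffOn le_rfl isOpen_Ioi.uniqueDiffOn hs.uniqueDiffOn (fun _ h => h) h0
    (C := B) (D := D) ?_ ?_
  · rw [iteratedFDerivWithin_of_isOpen m hs h0, norm_iteratedFDeriv_eq_norm_iteratedDeriv,
      Real.norm_eq_abs] at key
    refine key.trans ?_
    gcongr
    linarith
  · intro i hi
    rw [hf0, iteratedFDerivWithin_of_isOpen i isOpen_Ioi (Set.mem_Ioi.2 one_pos), hB]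
    exact Finset.single_le_sum
      (f := fun i => ‖iteratedFDeriv ℝ i (fun z : ℝ => z ^ p) 1‖)
      (fun i _ => norm_nonneg _) (Finset.mem_range.2 (by omega))
  · intro i hi _
    rw [iteratedFDerivWithin_of_isOpen i hs h0, norm_iteratedFDeriv_eq_norm_iteratedDeriv,
      Real.norm_eq_abs]
    match i, hi with
    | 1, _ => simpa [d1] using hb
    | 2, _ => simpa [iteratedDeriv_succ', d1, d2] using he
    | k + 3, _ =>
      simp only [iteratedDeriv_succ', d1, d2, deriv_const']
      simpa using pow_nonneg hD (k + 3)

theorem exists_abs_iteratedDeriv_norm_rpow_le (p : ℝ) (m : ℕ) :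
    ∃ C : ℝ, 0 < C ∧ ∀ {V : Type*} [NormedAddCommGroup V] [InnerProductSpace ℝ V]
      (y η : V), y ≠ 0 → ‖η‖ = 1 →
      |iteratedDeriv m (fun t : ℝ => ‖y + t • η‖ ^ p) 0| ≤ C * ‖y‖ ^ (p - m) := by
  obtain ⟨C, hC, h⟩ := Real.exists_abs_iteratedDeriv_quadratic_rpow_le (p / 2) m
  refine ⟨C * 2 ^ m, by positivity, fun y η hy hη => ?_⟩
  have hr : 0 < ‖y‖ := norm_pos_iff.2 hy
  have hfun : (fun t : ℝ => ‖y + t • η‖ ^ p) = fun t : ℝ =>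
      ‖y‖ ^ p * (1 + (2 * ⟪y, η⟫ / ‖y‖ ^ 2) * t + (1 / ‖y‖ ^ 2) * t ^ 2) ^ (p / 2) := by
    ext t
    have hsq : 1 + (2 * ⟪y, η⟫ / ‖y‖ ^ 2) * t + (1 / ‖y‖ ^ 2) * t ^ 2 =
        (‖y + t • η‖ / ‖y‖) ^ 2 := by
      rw [div_pow, norm_add_sq_real, inner_smul_right, norm_smul, hη, Real.norm_eq_abs, mul_one,
        sq_abs]
      field_simp
    rw [hsq, ← Real.rpow_natCast, ← Real.rpow_mul (by positivity), Nat.cast_ofNat,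
      mul_div_cancel₀ _ two_ne_zero, ← Real.mul_rpow hr.le (by positivity),
      mul_div_cancel₀ _ hr.ne']
  have hin : |⟪y, η⟫| ≤ ‖y‖ := by simpa [hη] using abs_real_inner_le_norm y η
  rw [hfun, iteratedDeriv_const_mul_field, abs_mul, abs_of_nonneg (by positivity)]
  have hq := h (2 * ⟪y, η⟫ / ‖y‖ ^ 2) (1 / ‖y‖ ^ 2) (2 / ‖y‖) ?_ ?_ (by positivity)
  · calc _ ≤ ‖y‖ ^ p * (C * (2 / ‖y‖) ^ m) := by gcongr
      _ = _ := by
        rw [Real.rpow_sub hr, Real.rpow_natCast, div_pow]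
        field_simp
  · rw [abs_div, abs_mul, abs_two, abs_of_nonneg (sq_nonneg ‖y‖), div_le_div_iff₀ (by positivity) hr]
    nlinarith
  · rw [abs_of_nonneg (by positivity), div_pow, mul_one_div]
    gcongr
    norm_num

theorem add_arccos_inner_le_norm_sub_smul {V : Type*} [NormedAddCommGroup V]
    [InnerProductSpace ℝ V] {x η : V} (hx : ‖x‖ = 1) (hη : ‖η‖ = 1) {ε : ℝ} (hε : 0 ≤ ε) :
    ε + Real.arccos ⟪x, η⟫ ≤ 3 * ‖x - (1 + ε) • η‖ := by
  have hin : |⟪x, η⟫| ≤ 1 := by simpa [hx, hη] using abs_real_inner_le_norm x η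
  obtain ⟨hl, hu⟩ := abs_le.1 hin
  have hsq : ‖x - (1 + ε) • η‖ ^ 2 = ε ^ 2 + 2 * (1 + ε) * (1 - ⟪x, η⟫) := by
    rw [norm_sub_sq_real, inner_smul_right, norm_smul, hη, hx, Real.norm_eq_abs, mul_one, sq_abs]
    ring
  have hθ := Real.arccos_nonneg ⟪x, η⟫
  have hcos := Real.cos_le_one_sub_mul_cos_sq (x := Real.arccos ⟪x, η⟫)
    (by rw [abs_of_nonneg hθ]; exact Real.arccos_le_pi _)
  rw [Real.cos_arccos hl hu] at hcos
  have hpi : (1 : ℝ) / 5 ≤ 2 / Real.pi ^ 2 := by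
    rw [div_le_div_iff₀ (by norm_num) (by positivity)]
    nlinarith [Real.pi_lt_d2, Real.pi_pos]
  refine abs_le_of_sq_le_sq' ?_ (by positivity) |>.2
  have h1 := mul_le_mul_of_nonneg_right hpi (sq_nonneg (Real.arccos ⟪x, η⟫))
  rw [mul_pow, hsq]
  nlinarith [sq_nonneg (ε - Real.arccos ⟪x, η⟫), mul_nonneg hε (sub_nonneg.2 hu)]

/-- Sharp localization estimate for `(η·∇)^m |x - aη|^{2-d}` on the unit sphere, `a = 1 + ε`.
The iterated directional derivative `(η·∇)^m`, applied to `y ↦ |y - aη|^{2-d}` and evaluated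
at `x`, is formalized as the `m`-th derivative at `t = 0` of `t ↦ ‖x + t • η - a • η‖^{2-d}`. -/
theorem stmt6 (d m : ℕ) (hd : 3 ≤ d) (hm : 1 ≤ m) :
    ∃ c : ℝ, 0 < c ∧ ∀ (ε : ℝ), 0 < ε → ε ≤ 1 →
      ∀ x η : EuclideanSpace ℝ (Fin d), ‖x‖ = 1 → ‖η‖ = 1 →
        |iteratedDeriv m (fun t : ℝ => ‖x + t • η - (1 + ε) • η‖ ^ ((2 : ℝ) - d)) 0| ≤
          c * ε ^ (-(m : ℝ) + 1) * ε ^ (-(d : ℝ) + 1) *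
            (1 + ε⁻¹ * Real.arccos ⟪x, η⟫) ^ (-((m : ℝ) + (d : ℝ) - 2)) := by
  obtain ⟨C, hC, h⟩ := exists_abs_iteratedDeriv_norm_rpow_le ((2 : ℝ) - d) m
  refine ⟨C * 3 ^ ((m : ℝ) + d - 2), by positivity, fun ε hε _ x η hx hη => ?_⟩
  have hθ := Real.arccos_nonneg ⟪x, η⟫
  have hlow := add_arccos_inner_le_norm_sub_smul hx hη hε.le
  have hy : x - (1 + ε) • η ≠ 0 := norm_pos_iff.1 (by linarith)
  have hd' : (3 : ℝ) ≤ d := by exact_mod_cast hd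
  have hfun : (fun t : ℝ => ‖x + t • η - (1 + ε) • η‖ ^ ((2 : ℝ) - d)) =
      fun t : ℝ => ‖(x - (1 + ε) • η) + t • η‖ ^ ((2 : ℝ) - d) := by
    ext t
    rw [add_sub_right_comm]
  rw [hfun]
  set q : ℝ := (m : ℝ) + d - 2 with hq
  have hq0 : 0 ≤ q := by
    have : (0 : ℝ) ≤ m := m.cast_nonneg
    linarith
  have hmain := h (x - (1 + ε) • η) η hy hη
  rw [show (2 : ℝ) - d - m = -q by rw [hq]; ring] at hmain
  calc _ ≤ C * ‖x - (1 + ε) • η‖ ^ (-q) := hmain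
    _ ≤ C * ((ε + Real.arccos ⟪x, η⟫) / 3) ^ (-q) := by
      gcongr ?_ * ?_
      exact Real.rpow_le_rpow_of_nonpos (by positivity) (by linarith) (by linarith)
    _ = _ := by
      rw [mul_assoc (C * 3 ^ q), ← Real.rpow_add hε,
        show -(m : ℝ) + 1 + (-(d : ℝ) + 1) = -q by rw [hq]; ring, mul_assoc (C * 3 ^ q),
        ← Real.mul_rpow hε.le (by positivity), mul_add, mul_one, mul_inv_cancel_left₀ hε.ne',
        Real.div_rpow (by positivity) (by norm_num), Real.rpow_neg (by norm_num : (0 : ℝ) ≤ 3),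
        div_inv_eq_mul]
      ring
end

section
/- Let d ≥ 3, m ∈ ℕ, a > 1, and η ∈ S^{d-1}. Then ∫_{S^{d-1}} (η·∇)^m |x−aη|^{2−d} dσ(x) = ω_d · m! · binom(m+d−3, m) · a^{−d+2−m}. -/
open scoped BigOperators RealInnerProductSpace
open MeasureTheory

/-- `ω_d = 2π^{d/2}/Γ(d/2)`, the surface measure of the unit sphere in `ℝ^d`. -/
noncomputable def omegaD (d : ℕ) : ℝ := 2 * Real.pi ^ ((d : ℝ) / 2) / Real.Gamma ((d : ℝ) / 2)

open Set Filter Topology Metric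
open scoped Pointwise ContDiff

/-- A linear isometry leaves integrals over the unit sphere invariant. -/
theorem integral_toSphere_comp_linearIsometryEquiv {E : Type*} [NormedAddCommGroup E]
    [InnerProductSpace ℝ E] [FiniteDimensional ℝ E] [MeasurableSpace E] [BorelSpace E]
    (ρ : E ≃ₗᵢ[ℝ] E) {f : E → ℝ} (hf : Continuous fun x : sphere (0 : E) 1 => f x) :
    ∫ x : sphere (0 : E) 1, f (ρ x) ∂(volume : Measure E).toSphere
      = ∫ x : sphere (0 : E) 1, f x ∂(volume : Measure E).toSphere := by
  let g : sphere (0 : E) 1 → sphere (0 : E) 1 := fun x => ⟨ρ x, by simp⟩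
  have hg : Continuous g := by fun_prop
  have hmap : (volume : Measure E).toSphere.map g = (volume : Measure E).toSphere := by
    ext s hs
    rw [Measure.map_apply hg.measurable hs, Measure.toSphere_apply' _ hs,
      Measure.toSphere_apply' _ (hg.measurable hs)]
    congr 1
    have hset : Ioo (0 : ℝ) 1 • ((↑) '' (g ⁻¹' s) : Set E) =
        ρ ⁻¹' (Ioo (0 : ℝ) 1 • ((↑) '' s : Set E)) := by
      ext y
      simp only [Set.mem_smul, mem_preimage]
      constructor
      · rintro ⟨r, hr, _, ⟨x, hx, rfl⟩, rfl⟩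
        exact ⟨r, hr, _, ⟨g x, hx, rfl⟩, by simp [g]⟩
      · rintro ⟨r, hr, _, ⟨x, hx, rfl⟩, h⟩
        refine ⟨r, hr, ρ.symm x, ⟨⟨ρ.symm x, by simp⟩, ?_, rfl⟩, ?_⟩
        · simpa [g] using hx
        · rw [← map_smul, h, ρ.symm_apply_apply]
    rw [hset]
    exact ρ.measurePreserving.measure_preimage_emb ρ.toHomeomorph.measurableEmbedding _
  conv_rhs => rw [← hmap]
  rw [integral_map hg.aemeasurable hf.aestronglyMeasurable]

/-- The unit sphere of `ℝ^d` has surface measure `ω_d`. -/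
theorem toSphere_real_univ_eq_omegaD {d : ℕ} (hd : 1 ≤ d) :
    (volume : Measure (EuclideanSpace ℝ (Fin d))).toSphere.real univ = omegaD d := by
  have : Nonempty (Fin d) := ⟨⟨0, hd⟩⟩
  have hd' : (0 : ℝ) < d / 2 := by positivity
  rw [Measure.toSphere_real_apply_univ, measureReal_def, EuclideanSpace.volume_ball, omegaD,
    Fintype.card_fin, Real.Gamma_add_one hd'.ne']
  have := Real.Gamma_pos_of_pos hd'
  rw [ENNReal.ofReal_one, one_pow, one_mul, ENNReal.toReal_ofReal (by positivity),
    Real.sqrt_eq_rpow, ← Real.rpow_natCast, ← Real.rpow_mul Real.pi_pos.le]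
  simp only [finrank_euclideanSpace, Fintype.card_fin]
  rw [show (1 / 2 : ℝ) * d = d / 2 by ring]
  field_simp

/-- Differentiation under the integral sign over a compact space. -/
theorem hasDerivAt_integral_of_continuousOn {X : Type*} [TopologicalSpace X] [CompactSpace X]
    [SecondCountableTopology X] [MeasurableSpace X] [OpensMeasurableSpace X] (μ : Measure X)
    [IsFiniteMeasure μ] {F F' : ℝ → X → ℝ} {J : Set ℝ} (hJ : IsOpen J)
    (hF : ∀ t ∈ J, Continuous (F t))
    (hF' : ContinuousOn (fun p : ℝ × X => F' p.1 p.2) (J ×ˢ univ))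
    (hd : ∀ t ∈ J, ∀ x, HasDerivAt (F · x) (F' t x) t) {t₀ : ℝ} (ht₀ : t₀ ∈ J) :
    HasDerivAt (fun t => ∫ x, F t x ∂μ) (∫ x, F' t₀ x ∂μ) t₀ := by
  obtain ⟨ε, hε, hεJ⟩ := Metric.nhds_basis_closedBall.mem_iff.1 (hJ.mem_nhds ht₀)
  have hK : IsCompact (closedBall t₀ ε ×ˢ (univ : Set X)) :=
    (isCompact_closedBall _ _).prod isCompact_univ
  obtain ⟨C, hC⟩ := hK.exists_bound_of_continuousOn (hF'.mono (prod_mono hεJ subset_rfl))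
  have hF'c : Continuous (F' t₀) := by
    rw [← continuousOn_univ]
    exact hF'.comp (f := fun x => (t₀, x)) (by fun_prop) fun x _ => ⟨ht₀, trivial⟩
  refine (hasDerivAt_integral_of_dominated_loc_of_deriv_le (bound := fun _ => C)
    (closedBall_mem_nhds t₀ hε) ?_ ?_ hF'c.aestronglyMeasurable ?_ (integrable_const C) ?_).2
  · filter_upwards [hJ.mem_nhds ht₀] with t ht using (hF t ht).aestronglyMeasurable
  · exact (hF t₀ ht₀).integrable_of_hasCompactSupport (HasCompactSupport.of_compactSpace _)
  · exact .of_forall fun x t ht => hC (t, x) ⟨ht, trivial⟩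
  · exact .of_forall fun x t ht => hd t (hεJ ht) x

/-- Iterated partial derivatives of a smooth function are smooth. -/
theorem ContDiffOn.exists_iteratedDeriv_eq {E : Type*} [NormedAddCommGroup E] [NormedSpace ℝ E]
    {G : ℝ × E → ℝ} {U : Set (ℝ × E)} (hU : IsOpen U) (hG : ContDiffOn ℝ ∞ G U) (m : ℕ) :
    ∃ H : ℝ × E → ℝ, ContDiffOn ℝ ∞ H U ∧
      ∀ p ∈ U, iteratedDeriv m (fun t => G (t, p.2)) p.1 = H p := by
  induction m with
  | zero => exact ⟨G, hG, by simp⟩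
  | succ m ih =>
    obtain ⟨H, hH, h⟩ := ih
    refine ⟨fun p => fderiv ℝ H p (1, 0),
      (hH.fderiv_of_isOpen hU (by simp)).clm_apply contDiffOn_const, ?_⟩
    rintro ⟨t, x⟩ hp
    rw [iteratedDeriv_succ]
    have hcont : Continuous fun s : ℝ => (s, x) := by fun_prop
    have hev : (iteratedDeriv m fun s => G (s, x)) =ᶠ[𝓝 t] fun s => H (s, x) := by
      filter_upwards [hcont.continuousAt.preimage_mem_nhds (hU.mem_nhds hp)] with s hs
      exact h _ hs
    rw [hev.deriv_eq]
    have h1 : HasFDerivAt H (fderiv ℝ H (t, x)) (t, x) :=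
      ((hH.contDiffAt (hU.mem_nhds hp)).differentiableAt (by simp)).hasFDerivAt
    exact (h1.comp_hasDerivAt t ((hasDerivAt_id t).prodMk (hasDerivAt_const t x))).deriv

/-- Iterated differentiation under the integral sign over a compact set of parameters. -/
theorem iteratedDeriv_integral_of_contDiffOn {E : Type*} [NormedAddCommGroup E] [NormedSpace ℝ E]
    [MeasurableSpace E] [BorelSpace E] [SecondCountableTopology E] {K : Set E} (hK : IsCompact K)
    (μ : Measure K) [IsFiniteMeasure μ] {G : ℝ × E → ℝ} {U : Set (ℝ × E)} (hU : IsOpen U)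
    (hG : ContDiffOn ℝ ∞ G U) {J : Set ℝ} (hJ : IsOpen J) (hJU : J ×ˢ K ⊆ U) (m : ℕ) :
    ∀ t ∈ J, iteratedDeriv m (fun t => ∫ x : K, G (t, x) ∂μ) t =
      ∫ x : K, iteratedDeriv m (fun t => G (t, x)) t ∂μ := by
  have : CompactSpace K := isCompact_iff_compactSpace.1 hK
  induction m with
  | zero => simp
  | succ m ih =>
    intro t ht
    obtain ⟨H, hH, hGH⟩ := hG.exists_iteratedDeriv_eq hU m
    obtain ⟨H', hH', hGH'⟩ := hG.exists_iteratedDeriv_eq hU (m + 1)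
    have hmem : ∀ s ∈ J, ∀ x : K, (s, (x : E)) ∈ U := fun s hs x => hJU ⟨hs, x.2⟩
    rw [iteratedDeriv_succ, EventuallyEq.deriv_eq (eventually_of_mem (hJ.mem_nhds ht) ih)]
    refine (hasDerivAt_integral_of_continuousOn
      (F := fun s (x : K) => iteratedDeriv m (fun t => G (t, x)) s)
      (F' := fun s (x : K) => iteratedDeriv (m + 1) (fun t => G (t, x)) s) μ hJ ?_ ?_ ?_ ht).deriv
    · intro s hs
      simp only [fun x : K => hGH _ (hmem s hs x)]
      exact hH.continuousOn.comp_continuous (by fun_prop) fun x => hmem s hs x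
    · refine ContinuousOn.congr (f := fun p : ℝ × K => H' (p.1, p.2)) ?_
        fun p hp => hGH' _ (hmem p.1 hp.1 p.2)
      exact hH'.continuousOn.comp (by fun_prop) fun p hp => hmem p.1 hp.1 p.2
    · intro s hs x
      rw [iteratedDeriv_succ]
      have hcont : Continuous fun r : ℝ => (r, (x : E)) := by fun_prop
      have hev : (iteratedDeriv m fun r => G (r, (x : E))) =ᶠ[𝓝 s] fun r => H (r, x) := by
        filter_upwards [hJ.mem_nhds hs] with r hr
        exact hGH _ (hmem r hr x)
      refine (hev.differentiableAt_iff.2 ?_).hasDerivAt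
      exact ((hH.contDiffAt (hU.mem_nhds (hmem s hs x))).differentiableAt (by simp)).comp s
        (by fun_prop)

/-- Infinitesimal rotation invariance of the surface measure in the plane spanned by two
orthonormal vectors `η` and `e`. -/
theorem integral_toSphere_inner_sq_mul_deriv {E : Type*} [NormedAddCommGroup E]
    [InnerProductSpace ℝ E] [FiniteDimensional ℝ E] [MeasurableSpace E] [BorelSpace E]
    {η e : E} (hη : ‖η‖ = 1) (he : ‖e‖ = 1) (hηe : ⟪η, e⟫ = 0) {g g' : ℝ → ℝ}
    (hg : ∀ s ∈ Icc (-1 : ℝ) 1, HasDerivAt g (g' s) s) (hg' : ContinuousOn g' (Icc (-1) 1)) :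
    ∫ x : sphere (0 : E) 1, ⟪e, (x : E)⟫ ^ 2 * g' ⟪η, (x : E)⟫ ∂(volume : Measure E).toSphere
      = ∫ x : sphere (0 : E) 1, ⟪η, (x : E)⟫ * g ⟪η, (x : E)⟫
          ∂(volume : Measure E).toSphere := by
  have hgc : ContinuousOn g (Icc (-1) 1) := fun s hs => (hg s hs).continuousAt.continuousWithinAt
  have hbd : ∀ x : E, ‖x‖ = 1 → ⟪η, x⟫ ∈ Icc (-1 : ℝ) 1 := fun x hx => by
    simpa [abs_le, hη, hx] using abs_real_inner_le_norm η x
  let n : ℝ → E := fun φ => Real.cos φ • η + Real.sin φ • e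
  have hn : ∀ φ, ‖n φ‖ = 1 := fun φ => by
    have : ‖n φ‖ ^ 2 = 1 := by
      simp [n, norm_add_sq_real, norm_smul, hη, he, inner_smul_left, inner_smul_right, hηe]
    exact (sq_eq_sq₀ (norm_nonneg _) zero_le_one).1 (by rw [this, one_pow])
  let ρ : ℝ → E ≃ₗᵢ[ℝ] E := fun φ => (ℝ ∙ n φ).reflection
  have hρ : ∀ φ x, ρ φ x = (2 * (Real.cos φ * ⟪η, x⟫ + Real.sin φ * ⟪e, x⟫)) • n φ - x :=
    fun φ x => by
      simp only [ρ, Submodule.reflection_singleton_apply, hn]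
      simp [n, inner_add_left, inner_smul_left, mul_smul, two_smul]
  let S : ℝ → E → ℝ := fun φ x =>
    2 * (Real.cos φ * ⟪η, x⟫ + Real.sin φ * ⟪e, x⟫) * Real.cos φ - ⟪η, x⟫
  let W : ℝ → E → ℝ := fun φ x =>
    2 * (Real.cos φ * ⟪η, x⟫ + Real.sin φ * ⟪e, x⟫) * Real.sin φ - ⟪e, x⟫
  have hS : ∀ φ x, ⟪η, ρ φ x⟫ = S φ x := fun φ x => by
    simp [hρ, S, n, inner_sub_right, inner_add_right, inner_smul_right, hη, hηe]
  have hW : ∀ φ x, ⟪e, ρ φ x⟫ = W φ x := fun φ x => by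
    simp [hρ, W, n, inner_sub_right, inner_add_right, inner_smul_right, he,
      real_inner_comm η e, hηe]
  have hSmem : ∀ φ (x : sphere (0 : E) 1), S φ x ∈ Icc (-1 : ℝ) 1 := fun φ x => by
    rw [← hS]; exact hbd _ (by simp)
  let S' : ℝ → E → ℝ := fun φ x =>
    2 * (-Real.sin φ * ⟪η, x⟫ + Real.cos φ * ⟪e, x⟫) * Real.cos φ +
      2 * (Real.cos φ * ⟪η, x⟫ + Real.sin φ * ⟪e, x⟫) * -Real.sin φ
  let W' : ℝ → E → ℝ := fun φ x =>
    2 * (-Real.sin φ * ⟪η, x⟫ + Real.cos φ * ⟪e, x⟫) * Real.sin φ +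
      2 * (Real.cos φ * ⟪η, x⟫ + Real.sin φ * ⟪e, x⟫) * Real.cos φ
  have hT : ∀ φ x, HasDerivAt
      (fun φ => 2 * (Real.cos φ * ⟪η, x⟫ + Real.sin φ * ⟪e, x⟫))
      (2 * (-Real.sin φ * ⟪η, x⟫ + Real.cos φ * ⟪e, x⟫)) φ := fun φ x =>
    (((Real.hasDerivAt_cos φ).mul_const _).add ((Real.hasDerivAt_sin φ).mul_const _)).const_mul 2
  have hSd : ∀ φ x, HasDerivAt (S · x) (S' φ x) φ := fun φ x =>
    ((hT φ x).mul (Real.hasDerivAt_cos φ)).sub_const _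
  have hWd : ∀ φ x, HasDerivAt (W · x) (W' φ x) φ := fun φ x =>
    ((hT φ x).mul (Real.hasDerivAt_sin φ)).sub_const _
  have hconst : ∀ φ, ∫ x : sphere (0 : E) 1, W φ x * g (S φ x) ∂(volume : Measure E).toSphere =
      ∫ x : sphere (0 : E) 1, ⟪e, (x : E)⟫ * g ⟪η, (x : E)⟫ ∂(volume : Measure E).toSphere := by
    intro φ
    rw [← integral_toSphere_comp_linearIsometryEquiv (ρ φ) (f := fun x => ⟪e, x⟫ * g ⟪η, x⟫)]
    · simp only [hS, hW]
    · exact (by fun_prop : Continuous fun x : sphere (0 : E) 1 => ⟪e, (x : E)⟫).mul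
        (hgc.comp_continuous (by fun_prop) fun x => hbd _ (by simp))
  have hderiv := hasDerivAt_integral_of_continuousOn
    (F := fun φ (x : sphere (0 : E) 1) => W φ x * g (S φ x))
    (F' := fun φ x => W' φ x * g (S φ x) + W φ x * (g' (S φ x) * S' φ x))
    (volume : Measure E).toSphere isOpen_univ
    (fun φ _ => by
      refine Continuous.mul (by fun_prop) (hgc.comp_continuous (by fun_prop) (hSmem φ)))
    (by
      refine Continuous.continuousOn (.add (.mul (by fun_prop) ?_) (.mul (by fun_prop)
        (.mul ?_ (by fun_prop))))
      · exact hgc.comp_continuous (by fun_prop) fun p => hSmem p.1 p.2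
      · exact hg'.comp_continuous (by fun_prop) fun p => hSmem p.1 p.2)
    (fun φ _ x => (hWd φ x).mul ((hg _ (hSmem φ x)).comp φ (hSd φ x)))
    (mem_univ (0 : ℝ))
  simp only [hconst] at hderiv
  have hzero := hderiv.unique (hasDerivAt_const _ _)
  simp only [W', W, S', S, Real.cos_zero, Real.sin_zero] at hzero
  have hinteg : ∀ f : sphere (0 : E) 1 → ℝ, Continuous f →
      Integrable f (volume : Measure E).toSphere := fun f hf =>
    hf.integrable_of_hasCompactSupport (HasCompactSupport.of_compactSpace _)
  have hgη : Continuous fun x : sphere (0 : E) 1 => g ⟪η, (x : E)⟫ :=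
    hgc.comp_continuous (by fun_prop) fun x => hbd _ (by simp)
  have hg'η : Continuous fun x : sphere (0 : E) 1 => g' ⟪η, (x : E)⟫ :=
    hg'.comp_continuous (by fun_prop) fun x => hbd _ (by simp)
  rw [← sub_eq_zero, ← integral_sub (hinteg _ (by exact .mul (by fun_prop) hg'η))
    (hinteg _ (by exact .mul (by fun_prop) hgη))]
  refine (mul_eq_zero.1 ?_).resolve_left (show (-2 : ℝ) ≠ 0 by norm_num)
  rw [← integral_const_mul, ← hzero]
  congr with x
  ring_nf

/-- Integration by parts on the sphere for functions of the coordinate along `η`. -/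
theorem integral_toSphere_one_sub_sq_mul_deriv {d : ℕ} {η : EuclideanSpace ℝ (Fin d)}
    (hη : ‖η‖ = 1) {g g' : ℝ → ℝ}
    (hg : ∀ s ∈ Icc (-1 : ℝ) 1, HasDerivAt g (g' s) s) (hg' : ContinuousOn g' (Icc (-1) 1)) :
    ∫ x : sphere (0 : EuclideanSpace ℝ (Fin d)) 1,
        (1 - ⟪η, (x : EuclideanSpace ℝ (Fin d))⟫ ^ 2) * g' ⟪η, (x : EuclideanSpace ℝ (Fin d))⟫
        ∂(volume : Measure (EuclideanSpace ℝ (Fin d))).toSphere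
      = ((d : ℝ) - 1) * ∫ x : sphere (0 : EuclideanSpace ℝ (Fin d)) 1,
          ⟪η, (x : EuclideanSpace ℝ (Fin d))⟫ * g ⟪η, (x : EuclideanSpace ℝ (Fin d))⟫
          ∂(volume : Measure (EuclideanSpace ℝ (Fin d))).toSphere := by
  have hd : 0 < d := by
    rcases Nat.eq_zero_or_pos d with rfl | h
    · simp [Subsingleton.elim η 0] at hη
    · exact h
  let i₀ : Fin d := ⟨0, hd⟩
  obtain ⟨b, hb⟩ := Orthonormal.exists_orthonormalBasis_extension_of_card_eq (𝕜 := ℝ)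
    (E := EuclideanSpace ℝ (Fin d)) (ι := Fin d) (by simp) (v := fun _ => η) (s := {i₀})
    (by
      rw [orthonormal_iff_ite]
      intro i j
      simp [Subsingleton.elim i j, hη])
  have hb₀ : b i₀ = η := hb i₀ rfl
  have hbd : ∀ x : sphere (0 : EuclideanSpace ℝ (Fin d)) 1,
      ⟪η, (x : EuclideanSpace ℝ (Fin d))⟫ ∈ Icc (-1 : ℝ) 1 := fun x => by
    simpa [abs_le, hη] using abs_real_inner_le_norm η (x : EuclideanSpace ℝ (Fin d))
  have hg'η : Continuous fun x : sphere (0 : EuclideanSpace ℝ (Fin d)) 1 =>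
      g' ⟪η, (x : EuclideanSpace ℝ (Fin d))⟫ :=
    hg'.comp_continuous (by fun_prop) hbd
  have hsum : ∀ x : sphere (0 : EuclideanSpace ℝ (Fin d)) 1,
      1 - ⟪η, (x : EuclideanSpace ℝ (Fin d))⟫ ^ 2 =
        ∑ i ∈ Finset.univ.erase i₀, ⟪b i, (x : EuclideanSpace ℝ (Fin d))⟫ ^ 2 := fun x => by
    have h := b.sum_sq_norm_inner_right (x : EuclideanSpace ℝ (Fin d))
    simp only [Real.norm_eq_abs, sq_abs, norm_eq_of_mem_sphere, one_pow] at h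
    rw [← Finset.add_sum_erase _ _ (Finset.mem_univ i₀), hb₀] at h
    linarith
  simp only [hsum, Finset.sum_mul]
  rw [integral_finsetSum _ fun i _ => Continuous.integrable_of_hasCompactSupport
    (by exact .mul (by fun_prop) hg'η) (HasCompactSupport.of_compactSpace _)]
  rw [Finset.sum_congr rfl fun i hi => integral_toSphere_inner_sq_mul_deriv hη (b.norm_eq_one i)
    (by rw [← hb₀]; exact b.inner_eq_zero (Finset.ne_of_mem_erase hi).symm) hg hg']
  simp [Finset.card_erase_of_mem, Nat.cast_sub (show 1 ≤ d from hd)]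

/-- The squared distance `1 - 2rs + r²` is positive for `|r| < 1` and `|s| ≤ 1`. -/
theorem one_sub_two_mul_add_sq_pos {r s : ℝ} (hr : r ∈ Ioo (-1 : ℝ) 1)
    (hs : s ∈ Icc (-1 : ℝ) 1) : 0 < 1 - 2 * r * s + r ^ 2 := by
  have h : (1 - |r|) ^ 2 ≤ 1 - 2 * r * s + r ^ 2 := by
    have h1 : r * s ≤ |r| := (le_abs_self _).trans <| by
      rw [abs_mul]; exact mul_le_of_le_one_right (abs_nonneg r) (abs_le.2 hs)
    nlinarith [sq_abs r]
  exact (pow_pos (sub_pos.2 (abs_lt.2 hr)) 2).trans_le h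

/-- Newton's theorem on the unit sphere: the Newtonian potential of the uniform mass distribution
is constant in the interior. -/
theorem integral_toSphere_rpow_eq_omegaD {d : ℕ} (hd : 2 ≤ d) {η : EuclideanSpace ℝ (Fin d)}
    (hη : ‖η‖ = 1) {r : ℝ} (hr : r ∈ Ioo (-1 : ℝ) 1) :
    ∫ x : sphere (0 : EuclideanSpace ℝ (Fin d)) 1,
        (1 - 2 * r * ⟪η, (x : EuclideanSpace ℝ (Fin d))⟫ + r ^ 2) ^ ((2 - d : ℝ) / 2)
        ∂(volume : Measure (EuclideanSpace ℝ (Fin d))).toSphere = omegaD d := by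
  set μ := (volume : Measure (EuclideanSpace ℝ (Fin d))).toSphere
  set p : ℝ := (2 - d : ℝ) / 2 with hp
  let J : Set ℝ := Ioo (-1) 1
  let s : sphere (0 : EuclideanSpace ℝ (Fin d)) 1 → ℝ := fun x =>
    ⟪η, (x : EuclideanSpace ℝ (Fin d))⟫
  have hsc : Continuous s := by fun_prop
  have hs : ∀ x, s x ∈ Icc (-1 : ℝ) 1 := fun x => by
    simpa [abs_le, hη] using abs_real_inner_le_norm η (x : EuclideanSpace ℝ (Fin d))
  let Q : ℝ → ℝ → ℝ := fun r s => 1 - 2 * r * s + r ^ 2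
  have hQ : ∀ r ∈ J, ∀ s ∈ Icc (-1 : ℝ) 1, 0 < Q r s := fun r hr s hs =>
    one_sub_two_mul_add_sq_pos hr hs
  have hQc : ∀ r ∈ J, ∀ q : ℝ, Continuous fun x => Q r (s x) ^ q := fun r hr q =>
    Continuous.rpow_const (by fun_prop) fun x => .inl (hQ r hr _ (hs x)).ne'
  have hQJ : ∀ q : ℝ, ContinuousOn
      (fun y : ℝ × sphere (0 : EuclideanSpace ℝ (Fin d)) 1 => Q y.1 (s y.2) ^ q) (J ×ˢ univ) :=
    fun q => ContinuousOn.rpow_const (by fun_prop) fun y hy => .inl (hQ _ hy.1 _ (hs _)).ne'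
  have hinteg : ∀ f : sphere (0 : EuclideanSpace ℝ (Fin d)) 1 → ℝ, Continuous f →
      Integrable f μ := fun f hf =>
    hf.integrable_of_hasCompactSupport (HasCompactSupport.of_compactSpace _)
  have hQr : ∀ r ∈ J, ∀ x, ∀ q : ℝ, HasDerivAt (fun r => Q r (s x) ^ q)
      ((2 * r - 2 * s x) * q * Q r (s x) ^ (q - 1)) r := fun r hr x q => by
    refine HasDerivAt.rpow_const ?_ (.inl (hQ r hr _ (hs x)).ne')
    refine (((((hasDerivAt_id r).const_mul 2).mul_const (s x)).const_sub 1).add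
      (hasDerivAt_pow 2 r)).congr_deriv ?_
    simp; ring
  let A : ℝ → ℝ := fun r => ∫ x, (r - s x) * Q r (s x) ^ (p - 1) ∂μ
  have hψ : ∀ r ∈ J, HasDerivAt (fun r => ∫ x, Q r (s x) ^ p ∂μ) (2 * p * A r) r := by
    intro r hr
    refine (hasDerivAt_integral_of_continuousOn (F := fun r x => Q r (s x) ^ p) μ isOpen_Ioo
      (fun r hr => hQc r hr p) ?_ (fun r hr x => hQr r hr x p) hr).congr_deriv ?_
    · exact ContinuousOn.mul (by fun_prop) (hQJ _)
    · rw [← integral_const_mul]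
      congr with x
      ring
  let B : ℝ → ℝ := fun r => ∫ x, (1 * Q r (s x) ^ (p - 1) +
    (r - s x) * ((2 * r - 2 * s x) * (p - 1) * Q r (s x) ^ (p - 1 - 1))) ∂μ
  have hA : ∀ r ∈ J, HasDerivAt A (B r) r := by
    intro r hr
    refine hasDerivAt_integral_of_continuousOn (F := fun r x => (r - s x) * Q r (s x) ^ (p - 1)) μ
      isOpen_Ioo (fun r hr => .mul (by fun_prop) (hQc r hr _)) ?_
      (fun r hr x => ((hasDerivAt_id r).sub_const _).mul (hQr r hr x _)) hr
    exact ContinuousOn.add (.mul (by fun_prop) (hQJ _))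
      (.mul (by fun_prop) (.mul (by fun_prop) (hQJ _)))
  have hAB : ∀ r ∈ J, ((d : ℝ) - 1) * A r + r * B r = 0 := by
    intro r hr
    have hg := integral_toSphere_one_sub_sq_mul_deriv hη (g := fun s => Q r s ^ (p - 1))
      (g' := fun s => (-(2 * r)) * (p - 1) * Q r s ^ (p - 1 - 1))
      (fun s hs => by
        refine HasDerivAt.rpow_const ?_ (.inl (hQ r hr _ hs).ne')
        refine ((((hasDerivAt_id s).const_mul (2 * r)).const_sub 1).add_const
          (r ^ 2)).congr_deriv ?_
        simp)
      (ContinuousOn.mul (by fun_prop) (ContinuousOn.rpow_const (by fun_prop)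
        fun s hs => .inl (hQ r hr _ hs).ne'))
    change ∫ x, (1 - s x ^ 2) * (-(2 * r) * (p - 1) * Q r (s x) ^ (p - 1 - 1)) ∂μ =
      ((d : ℝ) - 1) * ∫ x, s x * Q r (s x) ^ (p - 1) ∂μ at hg
    have c1 := hQc r hr (p - 1)
    have c2 := hQc r hr (p - 1 - 1)
    rw [← sub_eq_zero, ← integral_const_mul, ← integral_sub (hinteg _ (by fun_prop))
      (hinteg _ (by fun_prop))] at hg
    rw [← integral_const_mul, ← integral_const_mul, ← integral_add (hinteg _ (by fun_prop))
      (hinteg _ (by fun_prop)), ← hg]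
    congr with x
    have hpow : Q r (s x) ^ (p - 1) = Q r (s x) ^ (p - 1 - 1) * Q r (s x) := by
      rw [← Real.rpow_add_one (hQ r hr _ (hs x)).ne']; ring_nf
    rw [hpow]
    generalize Q r (s x) ^ (p - 1 - 1) = y
    simp only [Q]
    have hdp : (d : ℝ) = 2 - 2 * p := by rw [hp]; ring
    rw [hdp]
    ring
  have h0 : (0 : ℝ) ∈ J := by norm_num [J]
  have hAzero : ∀ r ∈ J, A r = 0 := by
    intro r hr
    have hd1 : (d : ℝ) - 1 ≠ 0 := by
      have : (2 : ℝ) ≤ d := by exact_mod_cast hd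
      linarith
    rcases eq_or_ne r 0 with rfl | hr0
    · simpa [hd1] using hAB 0 h0
    obtain ⟨k, rfl⟩ : ∃ k, d = k + 2 := ⟨d - 2, by omega⟩
    have hderiv : ∀ t ∈ J, HasDerivAt (fun t => t ^ (k + 1) * A t) 0 t := fun t ht => by
      refine ((hasDerivAt_pow (k + 1) t).mul (hA t ht)).congr_deriv ?_
      have := hAB t ht
      push_cast at this ⊢
      linear_combination t ^ k * this
    have heq := isOpen_Ioo.is_const_of_deriv_eq_zero isPreconnected_Ioo
      (fun t ht => (hderiv t ht).differentiableAt.differentiableWithinAt)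
      (fun t ht => (hderiv t ht).deriv) hr h0
    simpa [hr0] using heq
  have heq := isOpen_Ioo.is_const_of_deriv_eq_zero isPreconnected_Ioo
    (fun t ht => (hψ t ht).differentiableAt.differentiableWithinAt)
    (fun t ht => by rw [(hψ t ht).deriv, hAzero t ht]; simp) hr h0
  refine heq.trans ?_
  simp [Q, μ, ← toSphere_real_univ_eq_omegaD (show 1 ≤ d by omega)]

/-- Newton's theorem outside the unit sphere. -/
theorem integral_toSphere_rpow_eq_omegaD_mul {d : ℕ} (hd : 2 ≤ d) {η : EuclideanSpace ℝ (Fin d)}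
    (hη : ‖η‖ = 1) {b : ℝ} (hb : 1 < b) :
    ∫ x : sphere (0 : EuclideanSpace ℝ (Fin d)) 1,
        (1 - 2 * b * ⟪η, (x : EuclideanSpace ℝ (Fin d))⟫ + b ^ 2) ^ ((2 - d : ℝ) / 2)
        ∂(volume : Measure (EuclideanSpace ℝ (Fin d))).toSphere
      = omegaD d * b ^ (2 - d : ℝ) := by
  have hb0 : 0 < b := by linarith
  have hr : b⁻¹ ∈ Ioo (-1 : ℝ) 1 := ⟨by linarith [inv_pos.2 hb0], inv_lt_one_of_one_lt₀ hb⟩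
  rw [← integral_toSphere_rpow_eq_omegaD hd hη hr, ← integral_mul_const]
  congr with x
  have hs : ⟪η, (x : EuclideanSpace ℝ (Fin d))⟫ ∈ Icc (-1 : ℝ) 1 := by
    simpa [abs_le, hη] using abs_real_inner_le_norm η (x : EuclideanSpace ℝ (Fin d))
  have hbp : b ^ (2 - d : ℝ) = (b ^ 2) ^ ((2 - d : ℝ) / 2) := by
    rw [← Real.rpow_natCast, ← Real.rpow_mul hb0.le]
    congr 1
    push_cast
    ring
  rw [hbp, ← Real.mul_rpow (one_sub_two_mul_add_sq_pos hr hs).le (by positivity)]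
  congr 1
  field_simp
  ring

/-- Iterated derivatives of a negative power of `a - t`. -/
theorem iteratedDeriv_const_sub_rpow_neg (a : ℝ) (k m : ℕ) :
    ∀ t < a, iteratedDeriv m (fun t => (a - t) ^ (-((k : ℝ) + 1))) t =
      ((k + 1).ascFactorial m : ℝ) * (a - t) ^ (-((k : ℝ) + 1) - m) := by
  induction m with
  | zero => simp
  | succ m ih =>
    intro t ht
    rw [iteratedDeriv_succ, EventuallyEq.deriv_eq (eventually_of_mem (Iio_mem_nhds ht) ih)]
    have h := ((((hasDerivAt_id t).const_sub a).rpow_const (p := -((k : ℝ) + 1) - m)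
      (.inl (sub_pos.2 ht).ne')).const_mul ((k + 1).ascFactorial m : ℝ)).deriv
    refine h.trans ?_
    rw [Nat.ascFactorial_succ]
    push_cast
    rw [sub_sub _ (m : ℝ) 1]
    simp only [id]
    ring

/-- `∫_{S^{d-1}} (η·∇)^m |x-aη|^{2-d} dσ(x) = ω_d m! binom(m+d-3, m) a^{-d+2-m}`.
The iterated directional derivative `(η·∇)^m`, applied to `y ↦ |y - aη|^{2-d}` and evaluated
at `x`, is formalized as the `m`-th derivative at `t = 0` of `t ↦ ‖x + t • η - a • η‖^{2-d}`. -/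
theorem stmt7 (d m : ℕ) (hd : 3 ≤ d) (hm : 1 ≤ m) (a : ℝ) (ha : 1 < a)
    (η : EuclideanSpace ℝ (Fin d)) (hη : ‖η‖ = 1) :
    ∫ x : Metric.sphere (0 : EuclideanSpace ℝ (Fin d)) 1,
        iteratedDeriv m
          (fun t : ℝ => ‖(x : EuclideanSpace ℝ (Fin d)) + t • η - a • η‖ ^ ((2 : ℝ) - d)) 0
        ∂(volume : Measure (EuclideanSpace ℝ (Fin d))).toSphere
      = omegaD d * (m.factorial : ℝ) * ((m + d - 3).choose m : ℝ) *
          a ^ (-(d : ℝ) + 2 - (m : ℝ)) := by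
  let q : ℝ × EuclideanSpace ℝ (Fin d) → ℝ := fun p =>
    1 - 2 * (a - p.1) * ⟪η, p.2⟫ + (a - p.1) ^ 2
  have hq : ContDiff ℝ ∞ q := by
    have := contDiff_const.inner ℝ (contDiff_snd (𝕜 := ℝ) (n := ∞) (E := ℝ)) (f := fun _ => η)
    fun_prop
  have hqs : ∀ (t : ℝ) (x : EuclideanSpace ℝ (Fin d)), ‖x‖ = 1 →
      q (t, x) = ‖x + t • η - a • η‖ ^ 2 := fun t x hx => by
    rw [add_sub_assoc, ← sub_smul, norm_add_sq_real, norm_smul, inner_smul_right,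
      real_inner_comm, hη, hx, mul_one, Real.norm_eq_abs, sq_abs]
    simp only [q]
    ring
  have hnorm : ∀ x : sphere (0 : EuclideanSpace ℝ (Fin d)) 1,
      (fun t : ℝ => ‖(x : EuclideanSpace ℝ (Fin d)) + t • η - a • η‖ ^ ((2 : ℝ) - d)) =
        fun t => q (t, x) ^ ((2 - d : ℝ) / 2) := fun x => by
    ext t
    rw [hqs t x (by simp), ← Real.rpow_natCast, ← Real.rpow_mul (norm_nonneg _)]
    congr 1
    push_cast
    ring
  have hJU : Iio (a - 1) ×ˢ sphere (0 : EuclideanSpace ℝ (Fin d)) 1 ⊆ {p | 0 < q p} := by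
    rintro ⟨t, x⟩ ⟨ht, hx⟩
    have ht : t < a - 1 := ht
    have hx : ‖x‖ = 1 := by simpa using hx
    have hs : ⟪η, x⟫ ≤ 1 := by simpa [hη, hx] using real_inner_le_norm η x
    change 0 < 1 - 2 * (a - t) * ⟪η, x⟫ + (a - t) ^ 2
    nlinarith [mul_nonneg (show 0 ≤ a - t by linarith) (sub_nonneg.2 hs)]
  have h := iteratedDeriv_integral_of_contDiffOn (isCompact_sphere _ _)
    (volume : Measure (EuclideanSpace ℝ (Fin d))).toSphere
    (G := fun p => q p ^ ((2 - d : ℝ) / 2)) (isOpen_lt continuous_const hq.continuous)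
    (hq.contDiffOn.rpow_const_of_ne fun p hp => ne_of_gt hp) isOpen_Iio hJU m 0
    (by simpa using ha)
  simp only [hnorm]
  rw [← h]
  have hev : (fun t => ∫ x : sphere (0 : EuclideanSpace ℝ (Fin d)) 1, q (t, x) ^ ((2 - d : ℝ) / 2)
      ∂(volume : Measure (EuclideanSpace ℝ (Fin d))).toSphere) =ᶠ[𝓝 0]
      fun t => omegaD d * (a - t) ^ (2 - d : ℝ) := by
    filter_upwards [Iio_mem_nhds (show (0 : ℝ) < a - 1 by linarith)] with t ht
    have hb : 1 < a - t := by linarith [mem_Iio.1 ht]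
    exact integral_toSphere_rpow_eq_omegaD_mul (by omega) hη hb
  rw [hev.iteratedDeriv_eq m]
  obtain ⟨k, rfl⟩ : ∃ k, d = k + 3 := ⟨d - 3, by omega⟩
  rw [iteratedDeriv_const_mul_field]
  have hexp : (2 - (k + 3 : ℕ) : ℝ) = -((k : ℝ) + 1) := by push_cast; ring
  rw [hexp, iteratedDeriv_const_sub_rpow_neg a k m 0 (by linarith),
    Nat.ascFactorial_eq_factorial_mul_choose, show m + (k + 3) - 3 = k + m by omega]
  push_cast
  rw [sub_zero, show -((k : ℝ) + 3) + 2 - m = -((k : ℝ) + 1) - m by ring]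
  ring
end

section
/- Let d ≥ 2, m ≥ 1, 0 < ε ≤ 1, a := 1 + ε, and δ := 1 − a^{−2}. Define 𝓕_ε(t) := ((d/2)_{m−1}/(2·m!)) a^{2m} δ^{2m−1} (a² + 1 − 2at)^{−d/2+1−m} for t ∈ [−1,1]. Then for all x, η ∈ S^{d-1}: 𝓕_ε(x·η) = ((d/2)_{m−1}/(2·m!)) a^{2m} δ^{2m−1} |x − aη|^{−d+2−2m}, and there is a constant c₁ > 0 depending only on m and d such that 0 < 𝓕_ε(x·η) ≤ c₁ ε^{−d+1} (1 + ε^{−1} ρ(x,η))^{−(2m+d−2)}. -/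
open scoped BigOperators RealInnerProductSpace

/-- The kernel `𝓕_ε(t) = ((d/2)_{m-1}/(2·m!)) a^{2m} δ^{2m-1} (a² + 1 - 2at)^{-d/2+1-m}`,
where `a = 1 + ε` and `δ = 1 - a^{-2}`; `(u)_k` is the Pochhammer symbol
(`ascPochhammer`). -/
noncomputable def Fker (d m : ℕ) (ε t : ℝ) : ℝ :=
  (ascPochhammer ℝ (m - 1)).eval ((d : ℝ) / 2) / (2 * (m.factorial : ℝ)) *
    (1 + ε) ^ (2 * m) * (1 - ((1 + ε)⁻¹) ^ 2) ^ (2 * m - 1) *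
    ((1 + ε) ^ 2 + 1 - 2 * (1 + ε) * t) ^ (-(d : ℝ) / 2 + 1 - (m : ℝ))

theorem sq_le_sq_add_mul_one_sub_of_arccos {ε t : ℝ} (hε : 0 < ε) (h₁ : -1 ≤ t) (h₂ : t ≤ 1) :
    ((ε + Real.arccos t) / 3) ^ 2 ≤ (1 + ε) ^ 2 + 1 - 2 * (1 + ε) * t := by
  have hcos : Real.cos (Real.arccos t) = t := Real.cos_arccos h₁ h₂
  have hθ : 0 ≤ Real.arccos t := Real.arccos_nonneg t
  have hquad := Real.cos_le_one_sub_mul_cos_sq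
    (show |Real.arccos t| ≤ Real.pi by rw [abs_of_nonneg hθ]; exact Real.arccos_le_pi t)
  rw [hcos] at hquad
  have hpi : (1 / 5 : ℝ) ≤ 2 / Real.pi ^ 2 := by
    rw [div_le_div_iff₀ (by norm_num) (by positivity)]
    nlinarith [Real.pi_lt_d2, Real.pi_pos]
  have hsq := mul_le_mul_of_nonneg_right hpi (sq_nonneg (Real.arccos t))
  have ht : 0 ≤ ε * (1 - t) := mul_nonneg hε.le (by linarith)
  nlinarith [sq_nonneg (ε - Real.arccos t), sq_nonneg ε, sq_nonneg (Real.arccos t)]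

theorem norm_sub_smul_sq_of_norm_eq_one {E : Type*} [NormedAddCommGroup E]
    [InnerProductSpace ℝ E] {x y : E} (hx : ‖x‖ = 1) (hy : ‖y‖ = 1) (a : ℝ) :
    ‖x - a • y‖ ^ 2 = a ^ 2 + 1 - 2 * a * ⟪x, y⟫ := by
  rw [norm_sub_sq_real, inner_smul_right, norm_smul, hx, hy, mul_one, Real.norm_eq_abs, sq_abs]
  ring

theorem one_sub_inv_one_add_sq_pos {ε : ℝ} (hε : 0 < ε) : 0 < 1 - ((1 + ε)⁻¹) ^ 2 := by
  have h : (1 + ε)⁻¹ < 1 := inv_lt_one_of_one_lt₀ (by linarith)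
  have h' : 0 < (1 + ε)⁻¹ := by positivity
  nlinarith

theorem one_sub_inv_one_add_sq_le {ε : ℝ} (hε : 0 < ε) : 1 - ((1 + ε)⁻¹) ^ 2 ≤ 2 * ε := by
  have h : 1 - ε ≤ (1 + ε)⁻¹ := by
    rw [← one_div, le_div_iff₀ (by linarith)]
    nlinarith
  nlinarith [sq_nonneg ((1 + ε)⁻¹ - 1)]

theorem stmt8 (d m : ℕ) (hd : 2 ≤ d) (hm : 1 ≤ m) :
    ∃ c₁ : ℝ, 0 < c₁ ∧ ∀ (ε : ℝ), 0 < ε → ε ≤ 1 →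
      ∀ x η : EuclideanSpace ℝ (Fin d), ‖x‖ = 1 → ‖η‖ = 1 →
        Fker d m ε ⟪x, η⟫
            = (ascPochhammer ℝ (m - 1)).eval ((d : ℝ) / 2) / (2 * (m.factorial : ℝ)) *
                (1 + ε) ^ (2 * m) * (1 - ((1 + ε)⁻¹) ^ 2) ^ (2 * m - 1) *
                ‖x - (1 + ε) • η‖ ^ (-(d : ℝ) + 2 - 2 * (m : ℝ)) ∧
          0 < Fker d m ε ⟪x, η⟫ ∧
          Fker d m ε ⟪x, η⟫ ≤ c₁ * ε ^ (-(d : ℝ) + 1) *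
            (1 + ε⁻¹ * Real.arccos ⟪x, η⟫) ^ (-(2 * (m : ℝ) + (d : ℝ) - 2)) := by
  have hP : 0 < (ascPochhammer ℝ (m - 1)).eval ((d : ℝ) / 2) :=
    ascPochhammer_pos _ _ (by positivity)
  set C : ℝ := (ascPochhammer ℝ (m - 1)).eval ((d : ℝ) / 2) / (2 * (m.factorial : ℝ)) with hC
  have hCpos : 0 < C := by positivity
  have hd' : (2 : ℝ) ≤ d := by exact_mod_cast hd
  have hm' : (1 : ℝ) ≤ m := by exact_mod_cast hm
  set n : ℝ := 2 * (m : ℝ) + (d : ℝ) - 2 with hn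
  have hexp : -(d : ℝ) / 2 + 1 - (m : ℝ) = -n / 2 := by rw [hn]; ring
  have hexp' : -(d : ℝ) + 2 - 2 * (m : ℝ) = -n := by rw [hn]; ring
  refine ⟨C * 2 ^ (2 * m) * 2 ^ (2 * m - 1) * (3 : ℝ) ^ n, by positivity, ?_⟩
  intro ε hε hε1 x η hx hη
  have habs : |⟪x, η⟫| ≤ 1 := by simpa [hx, hη] using abs_real_inner_le_norm x η
  obtain ⟨h₁, h₂⟩ := abs_le.mp habs
  have hQ := sq_le_sq_add_mul_one_sub_of_arccos hε h₁ h₂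
  have hθ : 0 ≤ Real.arccos ⟪x, η⟫ := Real.arccos_nonneg _
  have hδ := one_sub_inv_one_add_sq_pos hε
  have hδ' := one_sub_inv_one_add_sq_le hε
  have hnorm := norm_sub_smul_sq_of_norm_eq_one hx hη (1 + ε)
  unfold Fker
  rw [← hC, hexp, hexp']
  set θ := Real.arccos ⟪x, η⟫
  set Q : ℝ := (1 + ε) ^ 2 + 1 - 2 * (1 + ε) * ⟪x, η⟫
  have hs : 0 < (ε + θ) / 3 := by positivity
  have hQpos : 0 < Q := lt_of_lt_of_le (by positivity) hQ
  have hpow (r : ℝ) (hr : 0 ≤ r) : (r ^ 2) ^ (-n / 2) = r ^ (-n) := by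
    rw [← Real.rpow_natCast, ← Real.rpow_mul hr]
    congr 1
    push_cast
    ring
  refine ⟨?_, by positivity, ?_⟩
  · rw [← hnorm, hpow _ (norm_nonneg _)]
  · have hbase : Q ^ (-n / 2) ≤ ((ε + θ) / 3) ^ (-n) := by
      rw [← hpow _ hs.le]
      exact Real.rpow_le_rpow_of_nonpos (by positivity) hQ (by linarith)
    have hsplit : ((ε + θ) / 3) ^ (-n) = (3 : ℝ) ^ n * ε ^ (-n) * (1 + ε⁻¹ * θ) ^ (-n) := by
      have h3 : (ε + θ) / 3 = 3⁻¹ * ε * (1 + ε⁻¹ * θ) := by field_simp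
      rw [h3, Real.mul_rpow (by positivity) (by positivity),
        Real.mul_rpow (by positivity) hε.le, Real.inv_rpow (by norm_num),
        Real.rpow_neg (by norm_num), inv_inv]
    have hεpow : ε ^ (2 * m - 1) * ε ^ (-n) = ε ^ (-(d : ℝ) + 1) := by
      rw [← Real.rpow_natCast, ← Real.rpow_add hε]
      congr 1
      rw [Nat.cast_sub (by omega), hn]
      push_cast
      ring
    calc C * (1 + ε) ^ (2 * m) * (1 - ((1 + ε)⁻¹) ^ 2) ^ (2 * m - 1) * Q ^ (-n / 2)
        ≤ C * 2 ^ (2 * m) * (2 * ε) ^ (2 * m - 1) * ((ε + θ) / 3) ^ (-n) := by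
          gcongr
          linarith
      _ = C * 2 ^ (2 * m) * 2 ^ (2 * m - 1) * (3 : ℝ) ^ n * (ε ^ (2 * m - 1) * ε ^ (-n)) *
            (1 + ε⁻¹ * θ) ^ (-n) := by
          rw [hsplit, mul_pow]
          ring
      _ = _ := by rw [hεpow]
end

section
/- Let d ≥ 2, m ≥ 1, 0 < ε ≤ 1, a := 1 + ε, and δ := 1 − a^{−2}. Define 𝓕_ε(t) := ((d/2)_{m−1}/(2·m!)) a^{2m} δ^{2m−1} (a² + 1 − 2at)^{−d/2+1−m} for t ∈ [−1,1]. Then there exists a constant c₂ > 0 depending only on m and d such that for every η ∈ S^{d-1}: ∫_{S^{d-1}} 𝓕_ε(x·η) dσ(x) ≥ c₂. -/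
open scoped BigOperators RealInnerProductSpace
open MeasureTheory

open scoped Pointwise

section Cap

variable {E : Type*} [NormedAddCommGroup E] [NormedSpace ℝ E]

/-- A ball of radius `ε / 16` centred at `t • η` lies in the cone over the spherical cap
of radius `ε` around `η`. -/
lemma ball_subset_cone_cap {η : E} (hη : ‖η‖ = 1) {ε t : ℝ} (hε : ε ≤ 1)
    (ht : 1 / 4 ≤ t) (ht' : t ≤ 1 / 2) :
    Metric.ball (t • η) (ε / 16) ⊆
      Set.Ioo (0 : ℝ) 1 • ((↑) '' {x : Metric.sphere (0 : E) 1 | ‖(x : E) - η‖ ≤ ε} : Set E) := by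
  intro y hy
  rw [Metric.mem_ball, dist_eq_norm] at hy
  have htη : ‖t • η‖ = t := by rw [norm_smul, hη, Real.norm_of_nonneg (by linarith), mul_one]
  have habs : |‖y‖ - t| < ε / 16 := by
    have h := abs_norm_sub_norm_le y (t • η)
    rw [htη] at h
    exact h.trans_lt hy
  obtain ⟨h₁, h₂⟩ := abs_lt.1 habs
  have hy8 : 1 / 8 < ‖y‖ := by linarith
  have hy0 : 0 < ‖y‖ := by linarith
  have hd : ‖y - ‖y‖ • η‖ ≤ ε * ‖y‖ := by
    have h : y - ‖y‖ • η = (y - t • η) - (‖y‖ - t) • η := by rw [sub_smul]; abel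
    have h' : ‖(‖y‖ - t) • η‖ = |‖y‖ - t| := by rw [norm_smul, hη, mul_one, Real.norm_eq_abs]
    have h'' := norm_sub_le (y - t • η) ((‖y‖ - t) • η)
    rw [← h, h'] at h''
    nlinarith [norm_nonneg (y - t • η)]
  refine Set.mem_smul.2 ⟨‖y‖, ⟨hy0, by linarith⟩, ‖y‖⁻¹ • y,
    ⟨⟨‖y‖⁻¹ • y, ?_⟩, ?_, rfl⟩, smul_inv_smul₀ hy0.ne' y⟩
  · rw [mem_sphere_zero_iff_norm, norm_smul, norm_inv, norm_norm, inv_mul_cancel₀ hy0.ne']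
  · have h : ‖y‖⁻¹ • y - η = ‖y‖⁻¹ • (y - ‖y‖ • η) := by
      rw [smul_sub, inv_smul_smul₀ hy0.ne']
    rw [Set.mem_ofPred_eq, h, norm_smul, norm_inv, norm_norm, inv_mul_le_iff₀ hy0, mul_comm]
    exact hd

variable [FiniteDimensional ℝ E] [MeasurableSpace E] [BorelSpace E]

/-- A spherical cap of radius `ε ≤ 1` has surface measure at least a constant times
`ε ^ (dim E - 1)`. -/
lemma le_toSphere_real_cap (μ : Measure E) [μ.IsAddHaarMeasure] {η : E} (hη : ‖η‖ = 1)
    {ε : ℝ} (hε₀ : 0 < ε) (hε : ε ≤ 1) :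
    Module.finrank ℝ E * (2 / ε * ((ε / 16) ^ Module.finrank ℝ E * μ.real (Metric.ball 0 1))) ≤
      μ.toSphere.real {x : Metric.sphere (0 : E) 1 | ‖(x : E) - η‖ ≤ ε} := by
  set S : Set (Metric.sphere (0 : E) 1) := {x | ‖(x : E) - η‖ ≤ ε}
  have : Nontrivial E := ⟨η, 0, by rintro rfl; simp at hη⟩
  have hS : MeasurableSet S :=
    (isClosed_le (by fun_prop) continuous_const).measurableSet
  let N := ⌈2 / ε⌉₊
  let c : ℕ → E := fun k => (1 / 4 + k * (ε / 8)) • η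
  have hdisj : Set.PairwiseDisjoint (Finset.range N : Set ℕ)
      fun k => Metric.ball (c k) (ε / 16) := by
    intro i _ j _ hij
    refine Metric.ball_disjoint_ball ?_
    have h : c i - c j = (((i : ℝ) - j) * (ε / 8)) • η := by
      simp only [c]; rw [← sub_smul]; congr 1; ring
    have hij' : (1 : ℝ) ≤ |(i : ℝ) - j| := by
      have : (1 : ℤ) ≤ |(i : ℤ) - j| := Int.one_le_abs (by omega)
      exact_mod_cast this
    rw [dist_eq_norm, h, norm_smul, hη, mul_one, Real.norm_eq_abs, abs_mul,
      abs_of_pos (by positivity : 0 < ε / 8)]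
    nlinarith
  have hsub : (⋃ k ∈ Finset.range N, Metric.ball (c k) (ε / 16)) ⊆
      Set.Ioo (0 : ℝ) 1 • ((↑) '' S : Set E) := by
    refine Set.iUnion₂_subset fun k hk => ?_
    have hk' : (k : ℝ) < 2 / ε := Nat.lt_ceil.1 (Finset.mem_range.1 hk)
    rw [lt_div_iff₀ hε₀] at hk'
    refine ball_subset_cone_cap hη hε ?_ ?_
    · have : 0 ≤ (k : ℝ) * (ε / 8) := by positivity
      linarith
    · linarith
  have hvol : μ.real (⋃ k ∈ Finset.range N, Metric.ball (c k) (ε / 16)) =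
      N * ((ε / 16) ^ Module.finrank ℝ E * μ.real (Metric.ball 0 1)) := by
    rw [measureReal_biUnion_finset hdisj fun _ _ => measurableSet_ball]
    have h₀ : 0 ≤ ε / 16 := by positivity
    simp [Measure.real, μ.addHaar_ball _ h₀, pow_nonneg h₀]
  have hfin : μ (Set.Ioo (0 : ℝ) 1 • ((↑) '' S : Set E)) ≠ ⊤ := by
    intro h
    have h' := μ.toSphere_apply' hS
    rw [h, ENNReal.mul_top (by exact_mod_cast Module.finrank_pos.ne')] at h'
    exact measure_ne_top _ _ h'
  have hreal : μ.toSphere.real S =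
      Module.finrank ℝ E * μ.real (Set.Ioo (0 : ℝ) 1 • ((↑) '' S : Set E)) := by
    simp [Measure.real, μ.toSphere_apply' hS]
  rw [hreal]
  gcongr
  refine le_trans ?_ (measureReal_mono hsub hfin)
  rw [hvol]
  gcongr
  exact Nat.le_ceil _

end Cap

lemma sq_add_one_sub_inner {E : Type*} [NormedAddCommGroup E] [InnerProductSpace ℝ E] {x η : E}
    (hx : ‖x‖ = 1) (hη : ‖η‖ = 1) (ε : ℝ) :
    (1 + ε) ^ 2 + 1 - 2 * (1 + ε) * ⟪x, η⟫ = ε ^ 2 + (1 + ε) * ‖x - η‖ ^ 2 := by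
  rw [norm_sub_sq_real, hx, hη]
  ring

lemma le_one_sub_inv_sq {ε : ℝ} (hε₀ : 0 < ε) (hε : ε ≤ 1) :
    ε / 2 ≤ 1 - ((1 + ε)⁻¹) ^ 2 := by
  have h : 1 - ((1 + ε)⁻¹) ^ 2 = ε * (2 + ε) / (1 + ε) ^ 2 := by
    field_simp
    ring
  rw [h, le_div_iff₀ (by positivity)]
  have : (1 + ε) ^ 2 ≤ 2 * (2 + ε) := by nlinarith
  nlinarith

lemma ascPochhammer_div_pos {d : ℕ} (hd : 0 < d) (m : ℕ) :
    0 < (ascPochhammer ℝ (m - 1)).eval ((d : ℝ) / 2) / (2 * (m.factorial : ℝ)) :=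
  div_pos (ascPochhammer_pos _ _ (by positivity)) (by positivity)

lemma Fker_nonneg {d m : ℕ} (hd : 0 < d) {ε t : ℝ} (hε₀ : 0 < ε) (hε : ε ≤ 1)
    (h : 0 ≤ (1 + ε) ^ 2 + 1 - 2 * (1 + ε) * t) : 0 ≤ Fker d m ε t := by
  have hδ : 0 ≤ 1 - ((1 + ε)⁻¹) ^ 2 := by linarith [le_one_sub_inv_sq hε₀ hε]
  have := (ascPochhammer_div_pos hd m).le
  have := Real.rpow_nonneg h (-(d : ℝ) / 2 + 1 - (m : ℝ))
  unfold Fker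
  positivity

/-- Where the base of the kernel is at most `3 * ε ^ 2`, the kernel is at least a constant times
`ε ^ (1 - d)`. -/
lemma le_Fker {d m : ℕ} (hd : 2 ≤ d) (hm : 1 ≤ m) {ε t : ℝ} (hε₀ : 0 < ε) (hε : ε ≤ 1)
    (h₀ : 0 < (1 + ε) ^ 2 + 1 - 2 * (1 + ε) * t)
    (h : (1 + ε) ^ 2 + 1 - 2 * (1 + ε) * t ≤ 3 * ε ^ 2) :
    (ascPochhammer ℝ (m - 1)).eval ((d : ℝ) / 2) / (2 * (m.factorial : ℝ)) *
      (1 / 2) ^ (2 * m - 1) * 3 ^ (-(d : ℝ) / 2 + 1 - (m : ℝ)) * (ε ^ (d - 1))⁻¹ ≤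
      Fker d m ε t := by
  have hK := (ascPochhammer_div_pos (by omega : 0 < d) m).le
  have hδ := le_one_sub_inv_sq hε₀ hε
  set K := (ascPochhammer ℝ (m - 1)).eval ((d : ℝ) / 2) / (2 * (m.factorial : ℝ))
  set p : ℝ := -(d : ℝ) / 2 + 1 - (m : ℝ)
  have hp : p ≤ 0 := by
    have : (2 : ℝ) ≤ d := by exact_mod_cast hd
    have : (1 : ℝ) ≤ m := by exact_mod_cast hm
    simp only [p]; linarith
  have hpow : ε ^ (2 * m - 1) * (ε ^ 2) ^ p = (ε ^ (d - 1))⁻¹ := by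
    rw [← Real.rpow_natCast, ← Real.rpow_natCast, ← Real.rpow_natCast, ← Real.rpow_mul hε₀.le,
      ← Real.rpow_neg hε₀.le, ← Real.rpow_add hε₀]
    congr 1
    rw [Nat.cast_sub (by omega), Nat.cast_sub (by omega)]
    simp only [p]; push_cast; ring
  calc K * (1 / 2) ^ (2 * m - 1) * 3 ^ p * (ε ^ (d - 1))⁻¹
      = K * 1 * (ε / 2) ^ (2 * m - 1) * (3 * ε ^ 2) ^ p := by
        rw [← hpow, Real.mul_rpow (by norm_num) (by positivity), div_pow, div_pow, one_pow]
        ring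
    _ ≤ Fker d m ε t := by
        have hδ₀ : 0 ≤ 1 - ((1 + ε)⁻¹) ^ 2 := by linarith
        have hrpow := Real.rpow_le_rpow_of_nonpos h₀ h hp
        have ha : 1 ≤ (1 + ε) ^ (2 * m) := one_le_pow₀ (by linarith)
        unfold Fker
        gcongr

theorem stmt9 (d m : ℕ) (hd : 2 ≤ d) (hm : 1 ≤ m) :
    ∃ c₂ : ℝ, 0 < c₂ ∧ ∀ (ε : ℝ), 0 < ε → ε ≤ 1 →
      ∀ η : EuclideanSpace ℝ (Fin d), ‖η‖ = 1 →
        c₂ ≤ ∫ x : Metric.sphere (0 : EuclideanSpace ℝ (Fin d)) 1,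
            Fker d m ε ⟪(x : EuclideanSpace ℝ (Fin d)), η⟫
            ∂(volume : Measure (EuclideanSpace ℝ (Fin d))).toSphere := by
  have hK := ascPochhammer_div_pos (by omega : 0 < d) m
  set V := (volume : Measure (EuclideanSpace ℝ (Fin d))).real (Metric.ball 0 1)
  have hV : 0 < V := ENNReal.toReal_pos (Metric.measure_ball_pos _ _ one_pos).ne'
    measure_ball_lt_top.ne
  have hd₀ : (0 : ℝ) < d := by exact_mod_cast (by omega : 0 < d)
  set C := (ascPochhammer ℝ (m - 1)).eval ((d : ℝ) / 2) / (2 * (m.factorial : ℝ)) *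
    (1 / 2) ^ (2 * m - 1) * 3 ^ (-(d : ℝ) / 2 + 1 - (m : ℝ))
  have hC : 0 < C := by positivity
  refine ⟨C * (d * (2 * ((1 / 16) ^ d * V))), by positivity, fun ε hε₀ hε η hη => ?_⟩
  have hbase (x : Metric.sphere (0 : EuclideanSpace ℝ (Fin d)) 1) :=
    sq_add_one_sub_inner (norm_eq_of_mem_sphere x) hη ε
  have hpos (x : Metric.sphere (0 : EuclideanSpace ℝ (Fin d)) 1) :
      0 < (1 + ε) ^ 2 + 1 - 2 * (1 + ε) * ⟪(x : EuclideanSpace ℝ (Fin d)), η⟫ := by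
    rw [hbase]; positivity
  have hcont : Continuous fun x : Metric.sphere (0 : EuclideanSpace ℝ (Fin d)) 1 =>
      Fker d m ε ⟪(x : EuclideanSpace ℝ (Fin d)), η⟫ := by
    unfold Fker
    exact continuous_const.mul
      (Continuous.rpow_const (by fun_prop) fun x => Or.inl (hpos x).ne')
  have hint : Integrable (fun x : Metric.sphere (0 : EuclideanSpace ℝ (Fin d)) 1 =>
      Fker d m ε ⟪(x : EuclideanSpace ℝ (Fin d)), η⟫)
      (volume : Measure (EuclideanSpace ℝ (Fin d))).toSphere :=
    hcont.integrable_of_hasCompactSupport (HasCompactSupport.of_compactSpace _)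
  set S : Set (Metric.sphere (0 : EuclideanSpace ℝ (Fin d)) 1) := {x | ‖(x : _) - η‖ ≤ ε}
  have hS : MeasurableSet S :=
    (isClosed_le (by fun_prop) continuous_const).measurableSet
  have hle : ∀ x ∈ S, C * (ε ^ (d - 1))⁻¹ ≤
      Fker d m ε ⟪(x : EuclideanSpace ℝ (Fin d)), η⟫ := by
    intro x hx
    refine le_Fker hd hm hε₀ hε (hpos x) ?_
    have hx' : ‖(x : EuclideanSpace ℝ (Fin d)) - η‖ ^ 2 ≤ ε ^ 2 :=
      pow_le_pow_left₀ (norm_nonneg _) hx 2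
    rw [hbase]
    nlinarith [sq_nonneg ‖(x : EuclideanSpace ℝ (Fin d)) - η‖]
  have hcap := le_toSphere_real_cap (volume : Measure (EuclideanSpace ℝ (Fin d))) hη hε₀ hε
  rw [finrank_euclideanSpace_fin] at hcap
  have hεd : ε ^ d = ε ^ (d - 1) * ε := by rw [← pow_succ]; congr 1; omega
  calc C * (d * (2 * ((1 / 16) ^ d * V)))
      = C * (ε ^ (d - 1))⁻¹ * (d * (2 / ε * ((ε / 16) ^ d * V))) := by
        rw [div_pow ε, hεd, div_pow]
        field_simp
        simp
    _ ≤ C * (ε ^ (d - 1))⁻¹ *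
        (volume : Measure (EuclideanSpace ℝ (Fin d))).toSphere.real S := by gcongr
    _ ≤ ∫ x in S, Fker d m ε ⟪(x : EuclideanSpace ℝ (Fin d)), η⟫
          ∂(volume : Measure (EuclideanSpace ℝ (Fin d))).toSphere :=
        setIntegral_ge_of_const_le_real hS (measure_ne_top _ _) hle hint.integrableOn
    _ ≤ _ := setIntegral_le_integral hint <|
        Filter.Eventually.of_forall fun x => Fker_nonneg (by omega) hε₀ hε (hpos x).le
end

section
/- Let 0 < ε ≤ 1, m ≥ 1, and η ∈ S¹ ⊂ ℝ². Define G_ε(x·η) := (2^{2m−2}/m) Σ_{n∈ℤ} ε^{−1} (1 + ε^{−2}(ρ(x,η) + 2πn)²)^{−m} for x ∈ S¹. Then G_ε satisfies 0 < G_ε(x·η) ≤ c ε^{−1}(1 + ε^{−1}ρ(x,η))^{−2m} for all x ∈ S¹ with a constant c depending only on m, and ∫_{S¹} G_ε(x·η) dσ(x) = π (2m−2)!/((m−1)! m!). -/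
open scoped BigOperators RealInnerProductSpace
open MeasureTheory

/-- The kernel `G_ε` on the unit circle, as a function of the geodesic distance `ρ`:
`G_ε = (2^{2m-2}/m) Σ_{n∈ℤ} ε⁻¹ (1 + ε⁻²(ρ + 2πn)²)^{-m}`. -/
noncomputable def Gker (m : ℕ) (ε ρ : ℝ) : ℝ :=
  (2 ^ (2 * m - 2) / (m : ℝ)) *
    ∑' n : ℤ, ε⁻¹ / (1 + ε⁻¹ ^ 2 * (ρ + 2 * Real.pi * (n : ℝ)) ^ 2) ^ m

theorem exists_linearIsometryEquiv_complex_map_one {η : EuclideanSpace ℝ (Fin 2)} (hη : ‖η‖ = 1) :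
    ∃ e : ℂ ≃ₗᵢ[ℝ] EuclideanSpace ℝ (Fin 2), e 1 = η := by
  let b := Complex.orthonormalBasisOneI.repr
  obtain ⟨z, hz⟩ : ∃ z : Circle, (z : ℂ) = b.symm η :=
    ⟨⟨b.symm η, mem_sphere_zero_iff_norm.2 (by rw [b.symm.norm_map, hη])⟩, rfl⟩
  refine ⟨(rotation z).trans b, ?_⟩
  rw [LinearIsometryEquiv.trans_apply, rotation_apply, mul_one, hz, b.apply_symm_apply]

theorem integral_toSphere_inner (f : ℝ → ℝ) {η : EuclideanSpace ℝ (Fin 2)} (hη : ‖η‖ = 1) :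
    ∫ x : Metric.sphere (0 : EuclideanSpace ℝ (Fin 2)) 1,
        f ⟪(x : EuclideanSpace ℝ (Fin 2)), η⟫
        ∂(volume : Measure (EuclideanSpace ℝ (Fin 2))).toSphere
      = ∫ θ in Set.Ioo (-Real.pi) Real.pi, f (Real.cos θ) := by
  obtain ⟨e, he⟩ := exists_linearIsometryEquiv_complex_map_one hη
  set h : ℝ → ℝ := (Set.Iio 1).indicator 1 with hh
  set F : EuclideanSpace ℝ (Fin 2) → ℝ := fun x ↦ f ⟪‖x‖⁻¹ • x, η⟫ * h ‖x‖ with hF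
  have hr : ∫ r in Set.Ioi (0 : ℝ), r * h r = 1 / 2 := by
    have : ∀ r, r * h r = (Set.Iio 1).indicator (fun r : ℝ ↦ r) r := by
      intro r; by_cases hr : r < 1 <;> simp [hh, hr]
    simp_rw [this]
    rw [setIntegral_indicator measurableSet_Iio, Set.Ioi_inter_Iio, ← integral_Ioc_eq_integral_Ioo,
      ← intervalIntegral.integral_of_le zero_le_one, integral_id]
    norm_num
  have hsphere : ∫ x, F x = (∫ x : Metric.sphere (0 : EuclideanSpace ℝ (Fin 2)) 1,
        f ⟪(x : EuclideanSpace ℝ (Fin 2)), η⟫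
        ∂(volume : Measure (EuclideanSpace ℝ (Fin 2))).toSphere) * (1 / 2) := by
    calc
      ∫ x, F x = ∫ x : ({(0)}ᶜ : Set (EuclideanSpace ℝ (Fin 2))), F x.1
          ∂((volume : Measure (EuclideanSpace ℝ (Fin 2))).comap (↑)) := by
        rw [integral_subtype_comap (measurableSet_singleton _).compl F,
          restrict_compl_singleton]
      _ = ∫ p : Metric.sphere (0 : EuclideanSpace ℝ (Fin 2)) 1 × Set.Ioi (0 : ℝ),
            f ⟪(p.1 : EuclideanSpace ℝ (Fin 2)), η⟫ * h p.2
          ∂((volume : Measure (EuclideanSpace ℝ (Fin 2))).toSphere.prod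
            (.volumeIoiPow (Module.finrank ℝ (EuclideanSpace ℝ (Fin 2)) - 1))) := by
        rw [← (Measure.measurePreserving_homeomorphUnitSphereProd
          (volume : Measure (EuclideanSpace ℝ (Fin 2)))).integral_comp
          (Homeomorph.measurableEmbedding _)]
        simp [hF]
      _ = _ := by
        rw [integral_prod_mul (fun x : Metric.sphere (0 : EuclideanSpace ℝ (Fin 2)) 1 ↦
          f ⟪(x : EuclideanSpace ℝ (Fin 2)), η⟫) (fun r : Set.Ioi (0 : ℝ) ↦ h r)]
        congr 1
        rw [← hr]
        simp only [Measure.volumeIoiPow, ENNReal.ofReal]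
        rw [integral_withDensity_eq_integral_smul
          ((measurable_subtype_coe.pow_const _).real_toNNReal),
          integral_subtype_comap measurableSet_Ioi fun a ↦ Real.toNNReal (a ^ _) • h a]
        refine setIntegral_congr_fun measurableSet_Ioi fun x hx ↦ ?_
        have hx' : (0 : ℝ) < x := hx
        simp [NNReal.smul_def, hx'.le]
  have hpolar : ∫ x, F x = (1 / 2) * ∫ θ in Set.Ioo (-Real.pi) Real.pi, f (Real.cos θ) := by
    rw [← e.measurePreserving.integral_comp e.toHomeomorph.measurableEmbedding,
      ← Complex.integral_comp_polarCoord_symm, polarCoord_target, ← hr,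
      ← setIntegral_prod_mul (fun r ↦ r * h r) (fun θ ↦ f (Real.cos θ)), Measure.volume_eq_prod]
    refine setIntegral_congr_fun (measurableSet_Ioi.prod measurableSet_Ioo) fun p hp ↦ ?_
    have hp' : (0 : ℝ) < p.1 := hp.1
    have hin : ⟪e (Complex.polarCoord.symm p), η⟫ = p.1 * Real.cos p.2 := by
      rw [← he, e.inner_map_map, Complex.inner]
      simp [Complex.cos_ofReal_re]
    simp only [hF, e.norm_map, Complex.norm_polarCoord_symm, abs_of_pos hp', real_inner_smul_left,
      hin, inv_mul_cancel_left₀ hp'.ne', smul_eq_mul]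
    ring
  linarith

theorem integrable_inv_one_add_sq_pow (m : ℕ) :
    Integrable fun t : ℝ ↦ ((1 + t ^ 2) ^ (m + 1))⁻¹ := by
  refine integrable_inv_one_add_sq.mono' (Continuous.aestronglyMeasurable
    (Continuous.inv₀ (f := fun t : ℝ ↦ (1 + t ^ 2) ^ (m + 1)) (by fun_prop)
      fun t ↦ by positivity)) (.of_forall fun t ↦ ?_)
  rw [Real.norm_of_nonneg (by positivity)]
  gcongr
  exact le_self_pow₀ (by nlinarith [sq_nonneg t]) (by simp)

theorem integral_inv_one_add_sq_pow_succ (m : ℕ) :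
    ∫ t : ℝ, ((1 + t ^ 2) ^ (m + 2) : ℝ)⁻¹ =
      ((2 * m + 1) / (2 * m + 2) : ℝ) * ∫ t : ℝ, ((1 + t ^ 2) ^ (m + 1) : ℝ)⁻¹ := by
  have hderiv : ∀ t : ℝ, HasDerivAt (fun t : ℝ ↦ t * ((1 + t ^ 2) ^ (m + 1))⁻¹)
      ((2 * m + 2) * ((1 + t ^ 2) ^ (m + 2))⁻¹ - (2 * m + 1) * ((1 + t ^ 2) ^ (m + 1))⁻¹) t := by
    intro t
    have h1 : HasDerivAt (fun t : ℝ ↦ 1 + t ^ 2) (2 * t) t := by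
      simpa using (hasDerivAt_pow 2 t).const_add 1
    have hpos : (0 : ℝ) < 1 + t ^ 2 := by positivity
    convert! (hasDerivAt_id t).mul ((h1.pow (m + 1)).inv (pow_pos hpos _).ne') using 1
    simp
    field_simp
    ring
  have hbound : ∀ t : ℝ, ‖t * ((1 + t ^ 2) ^ (m + 1))⁻¹‖ ≤ ‖t⁻¹‖ := by
    intro t
    rcases eq_or_ne t 0 with rfl | ht
    · simp
    have h2 : 1 + t ^ 2 ≤ (1 + t ^ 2) ^ (m + 1) :=
      le_self_pow₀ (by nlinarith [sq_nonneg t]) (by simp)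
    have ht' := abs_pos.2 ht
    rw [norm_mul, norm_inv, norm_inv, Real.norm_eq_abs, Real.norm_of_nonneg (by positivity),
      ← div_eq_mul_inv, div_le_iff₀ (by positivity), inv_mul_eq_div, le_div_iff₀ ht']
    nlinarith [sq_abs t]
  have key := integral_of_hasDerivAt_of_tendsto hderiv
    (((integrable_inv_one_add_sq_pow (m + 1)).const_mul _).sub
      ((integrable_inv_one_add_sq_pow m).const_mul _))
    (squeeze_zero_norm hbound (by simpa using (tendsto_inv_atBot_zero (𝕜 := ℝ)).norm))
    (squeeze_zero_norm hbound (by simpa using (tendsto_inv_atTop_zero (𝕜 := ℝ)).norm))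
  rw [integral_sub ((integrable_inv_one_add_sq_pow (m + 1)).const_mul _)
    ((integrable_inv_one_add_sq_pow m).const_mul _), integral_const_mul, integral_const_mul] at key
  rw [div_mul_eq_mul_div, eq_div_iff (by positivity)]
  linarith

theorem integral_inv_one_add_sq_pow (m : ℕ) :
    ∫ t : ℝ, ((1 + t ^ 2) ^ (m + 1) : ℝ)⁻¹ =
      Real.pi * (2 * m).factorial / (2 ^ (2 * m) * (m.factorial : ℝ) ^ 2) := by
  induction m with
  | zero => simp
  | succ m ih =>
    rw [integral_inv_one_add_sq_pow_succ, ih, show 2 * (m + 1) = 2 * m + 1 + 1 by ring,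
      Nat.factorial_succ, Nat.factorial_succ, Nat.factorial_succ]
    push_cast
    field_simp
    ring

theorem setIntegral_tsum_comp_add_two_pi {f : ℝ → ℝ} (hf : Integrable f) (hf0 : ∀ t, 0 ≤ f t) :
    ∫ θ in Set.Ioo (-Real.pi) Real.pi, ∑' n : ℤ, f (θ + 2 * Real.pi * n) = ∫ t, f t := by
  have hpi := Real.two_pi_pos
  set g : ℝ → ℝ := fun y ↦ f (2 * Real.pi * y - Real.pi) with hg
  have hgi : Integrable g := (hf.comp_sub_right Real.pi).comp_mul_left' hpi.ne'
  have hterm : ∀ n : ℤ, ∫ y in (0 : ℝ)..1, g (y + n) =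
      (2 * Real.pi)⁻¹ * ∫ θ in Set.Ioo (-Real.pi) Real.pi, f (θ + 2 * Real.pi * n) := by
    intro n
    rw [← integral_Ioc_eq_integral_Ioo, ← intervalIntegral.integral_of_le (by linarith)]
    have := intervalIntegral.integral_comp_mul_sub (a := 0) (b := 1)
      (fun θ ↦ f (θ + 2 * Real.pi * n)) hpi.ne' Real.pi
    rw [show 2 * Real.pi * 0 - Real.pi = -Real.pi by ring,
      show 2 * Real.pi * 1 - Real.pi = Real.pi by ring, smul_eq_mul] at this
    rw [← this]
    congr 1 with y
    simp only [hg]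
    ring_nf
  have hgint : ∫ y, g y = (2 * Real.pi)⁻¹ * ∫ t, f t := by
    rw [hg, Measure.integral_comp_mul_left (fun t ↦ f (t - Real.pi)),
      integral_sub_right_eq_self, abs_of_pos (by positivity), smul_eq_mul]
  have hsum : HasSum (fun n : ℤ ↦ ∫ θ in Set.Ioo (-Real.pi) Real.pi, f (θ + 2 * Real.pi * n))
      (∫ t, f t) := by
    have := hgi.hasSum_intervalIntegral_comp_add_int
    simp_rw [hterm, hgint] at this
    exact (hasSum_mul_left_iff (by positivity)).1 this
  rw [← hsum.tsum_eq]
  refine (integral_tsum_of_summable_integral_norm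
    (fun n ↦ (hf.comp_add_right _).integrableOn) ?_).symm
  simpa [abs_of_nonneg (hf0 _)] using hsum.summable

theorem Gker_neg (m : ℕ) (ε ρ : ℝ) : Gker m ε (-ρ) = Gker m ε ρ := by
  unfold Gker
  rw [← (Equiv.neg ℤ).tsum_eq]
  congr! 7 with n
  push_cast [Equiv.neg_apply]
  ring

theorem Gker_abs (m : ℕ) (ε ρ : ℝ) : Gker m ε |ρ| = Gker m ε ρ := by
  rcases abs_choice ρ with h | h <;> rw [h]
  exact Gker_neg m ε ρ

theorem summable_inv_one_add_int_sq_pow {m : ℕ} (hm : 1 ≤ m) :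
    Summable fun n : ℤ ↦ ((1 + (n : ℝ) ^ 2) ^ m)⁻¹ := by
  refine .of_norm_bounded_eventually (Real.summable_one_div_int_pow.2 one_lt_two) ?_
  filter_upwards [Filter.eventually_cofinite_ne (0 : ℤ)] with n hn
  have hn' : (0 : ℝ) < (n : ℝ) ^ 2 := by positivity
  rw [Real.norm_of_nonneg (by positivity), one_div]
  gcongr
  calc (n : ℝ) ^ 2 ≤ 1 + (n : ℝ) ^ 2 := by linarith
    _ ≤ (1 + (n : ℝ) ^ 2) ^ m := le_self_pow₀ (by linarith) (by lia)

theorem one_add_sq_mul_one_add_mul_sq_le {a ρ : ℝ} (ha : 1 ≤ a) (hρ0 : 0 ≤ ρ) (hρ : ρ ≤ Real.pi)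
    (n : ℤ) :
    (1 + (n : ℝ) ^ 2) * (1 + a * ρ) ^ 2 ≤ 8 * (1 + a ^ 2 * (ρ + 2 * Real.pi * n) ^ 2) := by
  have hpi := Real.pi_gt_three
  have h1 : (1 + a * ρ) ^ 2 ≤ 2 * (1 + (a * ρ) ^ 2) := by nlinarith [sq_nonneg (a * ρ - 1)]
  rcases eq_or_ne n 0 with rfl | hn
  · simp only [Int.cast_zero, mul_zero, add_zero]
    nlinarith [sq_nonneg (a * ρ)]
  have hn2 : (1 : ℝ) ≤ (n : ℝ) ^ 2 := by
    exact_mod_cast (one_le_sq_iff_one_le_abs n).2 (Int.one_le_abs hn)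
  have hs : (Real.pi * n) ^ 2 ≤ (ρ + 2 * Real.pi * n) ^ 2 := by
    have : 0 ≤ (ρ + Real.pi * n) * (ρ + 3 * (Real.pi * n)) := by
      rcases lt_or_gt_of_ne hn with h | h
      · have h' : (n : ℝ) ≤ -1 := by exact_mod_cast Int.le_sub_one_of_lt h
        have : Real.pi * n ≤ -Real.pi := by nlinarith
        exact mul_nonneg_of_nonpos_of_nonpos (by linarith) (by linarith)
      · have h' : (0 : ℝ) < n := by exact_mod_cast h
        positivity
    nlinarith
  have h2 : (a * ρ) ^ 2 ≤ (a * Real.pi) ^ 2 := by gcongr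
  have h3 : 1 ≤ (a * Real.pi) ^ 2 := one_le_pow₀ (by nlinarith)
  calc (1 + (n : ℝ) ^ 2) * (1 + a * ρ) ^ 2
      ≤ (2 * (n : ℝ) ^ 2) * (4 * (a * Real.pi) ^ 2) :=
        mul_le_mul (by linarith) (by linarith) (sq_nonneg _) (by positivity)
    _ = 8 * (a ^ 2 * (Real.pi * n) ^ 2) := by ring
    _ ≤ 8 * (1 + a ^ 2 * (ρ + 2 * Real.pi * n) ^ 2) := by
        have := mul_le_mul_of_nonneg_left hs (sq_nonneg a)
        linarith

theorem Gker_term_le (m : ℕ) {ε ρ : ℝ} (hε : 0 < ε) (hε1 : ε ≤ 1) (hρ0 : 0 ≤ ρ)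
    (hρ : ρ ≤ Real.pi) (n : ℤ) :
    ε⁻¹ / (1 + ε⁻¹ ^ 2 * (ρ + 2 * Real.pi * (n : ℝ)) ^ 2) ^ m ≤
      8 ^ m * ε⁻¹ / (1 + ε⁻¹ * ρ) ^ (2 * m) * ((1 + (n : ℝ) ^ 2) ^ m)⁻¹ := by
  have h := pow_le_pow_left₀ (by positivity)
    (one_add_sq_mul_one_add_mul_sq_le ((one_le_inv₀ hε).2 hε1) hρ0 hρ n) m
  rw [mul_pow, mul_pow, ← pow_mul] at h
  rw [← div_eq_mul_inv, div_div, div_le_div_iff₀ (by positivity) (by positivity)]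
  have := mul_le_mul_of_nonneg_left h (inv_pos.2 hε).le
  linarith

theorem summable_Gker_term {m : ℕ} (hm : 1 ≤ m) {ε ρ : ℝ} (hε : 0 < ε) (hε1 : ε ≤ 1)
    (hρ0 : 0 ≤ ρ) (hρ : ρ ≤ Real.pi) :
    Summable fun n : ℤ ↦ ε⁻¹ / (1 + ε⁻¹ ^ 2 * (ρ + 2 * Real.pi * (n : ℝ)) ^ 2) ^ m :=
  .of_nonneg_of_le (fun _ ↦ by positivity) (Gker_term_le m hε hε1 hρ0 hρ)
    ((summable_inv_one_add_int_sq_pow hm).mul_left _)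

theorem Gker_pos {m : ℕ} (hm : 1 ≤ m) {ε ρ : ℝ} (hε : 0 < ε) (hε1 : ε ≤ 1)
    (hρ0 : 0 ≤ ρ) (hρ : ρ ≤ Real.pi) : 0 < Gker m ε ρ := by
  have hm' : (0 : ℝ) < m := by exact_mod_cast hm
  exact mul_pos (by positivity) ((summable_Gker_term hm hε hε1 hρ0 hρ).tsum_pos
    (fun _ ↦ by positivity) 0 (by positivity))

theorem Gker_le {m : ℕ} (hm : 1 ≤ m) {ε ρ : ℝ} (hε : 0 < ε) (hε1 : ε ≤ 1)
    (hρ0 : 0 ≤ ρ) (hρ : ρ ≤ Real.pi) :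
    Gker m ε ρ ≤ (2 ^ (2 * m - 2) / (m : ℝ) * 8 ^ m * ∑' n : ℤ, ((1 + (n : ℝ) ^ 2) ^ m)⁻¹) *
      ε⁻¹ / (1 + ε⁻¹ * ρ) ^ (2 * m) := by
  have hle := (summable_Gker_term hm hε hε1 hρ0 hρ).tsum_le_tsum (Gker_term_le m hε hε1 hρ0 hρ)
    ((summable_inv_one_add_int_sq_pow hm).mul_left _)
  rw [tsum_mul_left] at hle
  calc Gker m ε ρ ≤ _ := mul_le_mul_of_nonneg_left hle (by positivity)
    _ = _ := by ring

theorem setIntegral_Gker (m : ℕ) {ε : ℝ} (hε : 0 < ε) :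
    ∫ θ in Set.Ioo (-Real.pi) Real.pi, Gker (m + 1) ε θ =
      Real.pi * (2 * m).factorial / (m.factorial * (m + 1).factorial) := by
  have hterm : ∀ t : ℝ, ε⁻¹ / (1 + ε⁻¹ ^ 2 * t ^ 2) ^ (m + 1) =
      ε⁻¹ * ((1 + (ε⁻¹ * t) ^ 2) ^ (m + 1))⁻¹ := fun t ↦ by rw [mul_pow, div_eq_mul_inv]
  have hint : Integrable fun t : ℝ ↦ ε⁻¹ / (1 + ε⁻¹ ^ 2 * t ^ 2) ^ (m + 1) := by
    simp_rw [hterm]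
    exact ((integrable_inv_one_add_sq_pow m).comp_mul_left' (inv_pos.2 hε).ne').const_mul _
  unfold Gker
  rw [integral_const_mul, setIntegral_tsum_comp_add_two_pi hint fun t ↦ by positivity]
  simp_rw [hterm]
  rw [integral_const_mul, Measure.integral_comp_mul_left (fun t ↦ ((1 + t ^ 2) ^ (m + 1))⁻¹),
    integral_inv_one_add_sq_pow, inv_inv, abs_of_pos hε, smul_eq_mul, inv_mul_cancel_left₀ hε.ne',
    show 2 * (m + 1) - 2 = 2 * m by lia, Nat.factorial_succ]
  push_cast
  field_simp

theorem stmt17 (m : ℕ) (hm : 1 ≤ m) :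
    ∃ c : ℝ, 0 < c ∧ ∀ (ε : ℝ), 0 < ε → ε ≤ 1 →
      ∀ η : EuclideanSpace ℝ (Fin 2), ‖η‖ = 1 →
        (∀ x : EuclideanSpace ℝ (Fin 2), ‖x‖ = 1 →
          0 < Gker m ε (Real.arccos ⟪x, η⟫) ∧
            Gker m ε (Real.arccos ⟪x, η⟫) ≤
              c * ε⁻¹ / (1 + ε⁻¹ * Real.arccos ⟪x, η⟫) ^ (2 * m)) ∧
        ∫ x : Metric.sphere (0 : EuclideanSpace ℝ (Fin 2)) 1,
            Gker m ε (Real.arccos ⟪(x : EuclideanSpace ℝ (Fin 2)), η⟫)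
            ∂(volume : Measure (EuclideanSpace ℝ (Fin 2))).toSphere
          = Real.pi * ((2 * m - 2).factorial : ℝ) /
              (((m - 1).factorial : ℝ) * (m.factorial : ℝ)) := by
  have hS := summable_inv_one_add_int_sq_pow hm
  have hm' : (0 : ℝ) < m := by exact_mod_cast hm
  refine ⟨2 ^ (2 * m - 2) / (m : ℝ) * 8 ^ m * ∑' n : ℤ, ((1 + (n : ℝ) ^ 2) ^ m)⁻¹,
    mul_pos (by positivity) (hS.tsum_pos (fun _ ↦ by positivity) 0 (by positivity)),
    fun ε hε hε1 η hη ↦ ⟨fun x _ ↦ ?_, ?_⟩⟩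
  · exact ⟨Gker_pos hm hε hε1 (Real.arccos_nonneg _) (Real.arccos_le_pi _),
      Gker_le hm hε hε1 (Real.arccos_nonneg _) (Real.arccos_le_pi _)⟩
  · obtain ⟨k, rfl⟩ := Nat.exists_eq_add_of_le' hm
    rw [integral_toSphere_inner (fun s ↦ Gker (k + 1) ε (Real.arccos s)) hη,
      show 2 * (k + 1) - 2 = 2 * k by lia, Nat.add_sub_cancel, ← setIntegral_Gker k hε]
    refine setIntegral_congr_fun measurableSet_Ioo fun θ hθ ↦ ?_
    have hθ' : |θ| ≤ Real.pi := abs_le.2 ⟨hθ.1.le, hθ.2.le⟩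
    rw [← Real.cos_abs, Real.arccos_cos (abs_nonneg θ) hθ', Gker_abs]
end
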